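/- Let Ω ⊂ ℝ^n be a bounded domain with boundary of class C^{1+ε}, 0 < ε < 1, and let T be an even smooth homogeneous Calderón–Zygmund operator with kernel K. Then for every f ∈ Lip(ε,Ω) and every x ∈ Ω the principal value Tf(x) = lim_{δ→0+} ∫_{y∈Ω, |y−x|>δ} f(y) K(x−y) dy exists, and the resulting function satisfies ‖Tf‖_{ε,Ω} ≤ C ‖T‖_CZ ‖f‖_{ε,Ω}, where C depends only on n, ε and Ω. -/

import Mathlib

open MeasureTheory Metric Set Filter Topology
open scoped ENNReal NNReal

noncomputable section

/-- `ℝ^n` with the Euclidean norm. -/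
abbrev En (n : ℕ) : Type := EuclideanSpace ℝ (Fin n)

/-- The Hölder norm `‖f‖_{ε,Ω} = sup_Ω |f| + σ_ε(f)`, valued in `ℝ≥0∞`. -/
def holderNorm {X : Type*} [NormedAddCommGroup X] (ε : ℝ) (Ω : Set X) (f : X → ℂ) : ℝ≥0∞ :=
  (⨆ x : Ω, (‖f x.1‖₊ : ℝ≥0∞)) +
    ⨆ p : Ω × Ω, ENNReal.ofReal (‖f p.1.1 - f p.2.1‖ / ‖p.1.1 - p.2.1‖ ^ ε)

/-- The Calderón–Zygmund constant `‖T‖_CZ = sup_{x≠0}|K(x)||x|^n + sup_{x≠0}|∇K(x)||x|^{n+1}`. -/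
def czConst (n : ℕ) (K : En n → ℝ) : ℝ≥0∞ :=
  (⨆ x : {x : En n // x ≠ 0}, ENNReal.ofReal (|K x.1| * ‖x.1‖ ^ n)) +
    ⨆ x : {x : En n // x ≠ 0}, ENNReal.ofReal (‖fderiv ℝ K x.1‖ * ‖x.1‖ ^ (n + 1))

/-- `Ω ⊆ ℝ^n` has boundary of class `C^{1+ε}`: near each boundary point, after a rotation,
`Ω` is the subgraph of a `C^1` function whose gradient is `ε`-Hölder. -/
def HasC1HolderBoundary (n : ℕ) (ε : ℝ) (Ω : Set (En n)) : Prop :=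
  ∃ hn : 0 < n, ∀ a ∈ frontier Ω, ∃ r > 0,
    ∃ R : En n ≃ₗᵢ[ℝ] En n, ∃ φ : (Fin (n - 1) → ℝ) → ℝ,
      ContDiff ℝ 1 φ ∧
      (∃ c : ℝ≥0, HolderOnWith c ε.toNNReal (fderiv ℝ φ) univ) ∧
      Ω ∩ ball a r = {x ∈ ball a r |
        R x ⟨n - 1, Nat.sub_lt hn Nat.one_pos⟩ <
          φ fun i : Fin (n - 1) => R x (Fin.castLE (Nat.sub_le n 1) i)}

theorem uniq_aux {X : Type*} [MetricSpace X] [CompactSpace X] [MeasurableSpace X] [BorelSpace X]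
    (μ ν : Measure X) [IsFiniteMeasure μ] [IsFiniteMeasure ν]
    (hμ : ∀ r > 0, ∀ x y : X, μ (ball x r) = μ (ball y r))
    (hν : ∀ r > 0, ∀ x y : X, ν (ball x r) = ν (ball y r))
    (hpos : ∀ r > 0, ∀ x : X, 0 < μ (ball x r))
    (f : X → ℝ) (hf : Continuous f) (h0 : ∫ x, f x ∂μ = 0) : ∫ x, f x ∂ν = 0 := by
  rcases isEmpty_or_nonempty X with hX | ⟨⟨x0⟩⟩
  · simp [Measure.eq_zero_of_isEmpty]
  have huc := CompactSpace.uniformContinuous_of_continuous hf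
  rw [Metric.uniformContinuous_iff] at huc
  have key : ∀ η > 0, |∫ x, f x ∂ν| ≤ η * ν.real univ := by
    intro η hη
    obtain ⟨r, hr, hfr⟩ := huc η hη
    set m := μ.real (ball x0 r) with hm
    have hmpos : 0 < m := by
      rw [hm, Measure.real]
      exact ENNReal.toReal_pos (hpos r hr x0).ne' (measure_ne_top _ _)
    have hfi : ∀ κ : Measure X, IsFiniteMeasure κ → Integrable f κ := by
      intro κ _
      exact hf.integrable_of_hasCompactSupport (HasCompactSupport.of_compactSpace f)
    let D : Set (X × X) := {p | dist p.1 p.2 < r}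
    have hD : MeasurableSet D := (isOpen_lt (by fun_prop) (by fun_prop)).measurableSet
    let G : X × X → ℝ := D.indicator (fun p => f p.1)
    have hGi : Integrable G (μ.prod ν) := by
      apply Integrable.indicator _ hD
      exact (hfi μ inferInstance).comp_fst ν
    have e1 : ∫ p, G p ∂(μ.prod ν) = 0 := by
      rw [integral_prod _ hGi]
      have : ∀ x, ∫ y, G (x, y) ∂ν = f x * ν.real (ball x0 r) := by
        intro x
        have : (fun y => G (x, y)) = (ball x r).indicator (fun _ => f x) := by
          ext y
          simp only [G, D, indicator, mem_ofPred_eq, mem_ball, dist_comm x y]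
        rw [this, integral_indicator measurableSet_ball, setIntegral_const, smul_eq_mul, mul_comm]
        rw [Measure.real, Measure.real, hν r hr x x0]
      simp_rw [this]
      rw [integral_mul_const, h0, zero_mul]
    have e2 : ∫ p, G p ∂(μ.prod ν) = ∫ y, (∫ x in ball y r, f x ∂μ) ∂ν := by
      rw [integral_prod_symm _ hGi]
      congr 1
      ext y
      have : (fun x => G (x, y)) = (ball y r).indicator f := by
        ext x
        simp only [G, D, indicator, mem_ofPred_eq, mem_ball]
      rw [this, integral_indicator measurableSet_ball]
    have hGy : Integrable (fun y => ∫ x in ball y r, f x ∂μ) ν := by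
      have := hGi.integral_prod_right
      refine this.congr (Eventually.of_forall fun y => ?_)
      have : (fun x => G (x, y)) = (ball y r).indicator f := by
        ext x
        simp only [G, D, indicator, mem_ofPred_eq, mem_ball]
      simp only [this, integral_indicator measurableSet_ball]
    have e3 : ∫ y, ((∫ x in ball y r, f x ∂μ) - m * f y) ∂ν = - (m * ∫ y, f y ∂ν) := by
      rw [integral_sub hGy ((hfi ν inferInstance).const_mul m), ← e2, e1, integral_const_mul]
      ring
    have e4 : ∀ y, ‖(∫ x in ball y r, f x ∂μ) - m * f y‖ ≤ η * m := by
      intro y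
      have hmy : μ.real (ball y r) = m := by
        rw [hm, Measure.real, Measure.real, hμ r hr y x0]
      have : (∫ x in ball y r, f x ∂μ) - m * f y = ∫ x in ball y r, (f x - f y) ∂μ := by
        rw [integral_sub (hfi μ inferInstance).integrableOn (integrable_const _),
          setIntegral_const, hmy, smul_eq_mul]
      rw [this, ← hmy]
      apply norm_setIntegral_le_of_norm_le_const (measure_lt_top _ _)
      intro x hx
      exact (hfr hx).le
    have e5 : ‖∫ y, ((∫ x in ball y r, f x ∂μ) - m * f y) ∂ν‖ ≤ η * m * ν.real univ :=
      norm_integral_le_of_norm_le_const (Eventually.of_forall e4)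
    rw [e3, norm_neg, Real.norm_eq_abs, abs_mul, abs_of_pos hmpos] at e5
    have : m * |∫ y, f y ∂ν| ≤ m * (η * ν.real univ) := by linarith
    exact le_of_mul_le_mul_left this hmpos
  have : |∫ x, f x ∂ν| ≤ 0 := by
    apply le_of_forall_pos_le_add
    intro δ hδ
    have hb : 0 ≤ ν.real univ := measureReal_nonneg
    have := key (δ / (ν.real univ + 1)) (by positivity)
    refine this.trans ?_
    rw [zero_add, div_mul_eq_mul_div, div_le_iff₀ (by positivity)]
    nlinarith
  exact abs_eq_zero.mp (le_antisymm this (abs_nonneg _))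

/-- isometry of sphere moving x to y -/
theorem sphere_trans {n : ℕ} (x y : sphere (0 : En n) 1) :
    ∃ L : En n ≃ₗᵢ[ℝ] En n, L x.1 = y.1 := by
  refine ⟨Submodule.reflection (Submodule.span ℝ {x.1 - y.1})ᗮ, ?_⟩
  apply Submodule.reflection_sub
  have h1 := x.2; have h2 := y.2
  simp only [mem_sphere_iff_norm, sub_zero] at h1 h2
  rw [h1, h2]

theorem toSphere_ball_eq {n : ℕ} (r : ℝ) (x y : sphere (0 : En n) 1) :
    (volume : Measure (En n)).toSphere (ball x r) = (volume : Measure (En n)).toSphere (ball y r) := by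
  obtain ⟨L, hL⟩ := sphere_trans x y
  symm
  rw [Measure.toSphere_apply' _ measurableSet_ball, Measure.toSphere_apply' _ measurableSet_ball]
  congr 1
  rw [← L.measurePreserving.measure_preimage_equiv (f := L.toMeasurableEquiv)]
  congr 1
  ext z
  simp only [mem_preimage, Set.mem_smul, mem_image]
  constructor
  · rintro ⟨t, ht, w, ⟨v, hvb, rfl⟩, h⟩
    refine ⟨t, ht, L.symm v.1, ⟨⟨L.symm v.1, by simp⟩, ?_, rfl⟩, ?_⟩
    · have : dist (L.symm v.1) (L.symm y.1) = dist v.1 y.1 := L.symm.dist_map _ _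
      rw [mem_ball, Subtype.dist_eq] at hvb ⊢
      have h2 : L.symm y.1 = x.1 := by rw [← hL]; simp
      simp only
      rw [← h2, this]; exact hvb
    · apply L.injective
      rw [map_smul, L.apply_symm_apply]
      exact h
  · rintro ⟨t, ht, w, ⟨v, hvb, rfl⟩, rfl⟩
    refine ⟨t, ht, L v.1, ⟨⟨L v.1, by simp⟩, ?_, rfl⟩, ?_⟩
    · have : dist (L v.1) (L x.1) = dist v.1 x.1 := L.dist_map _ _
      rw [mem_ball, Subtype.dist_eq] at hvb ⊢
      simp only
      rw [← hL, this]; exact hvb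
    · exact (L.map_smul t v.1).symm

theorem hausdorff_ball_eq {n : ℕ} (d r : ℝ) (hd : 0 ≤ d) (x y : sphere (0 : En n) 1) :
    (μH[d] : Measure (sphere (0 : En n) 1)) (ball x r) = μH[d] (ball y r) := by
  obtain ⟨L, hL⟩ := sphere_trans x y
  have h1 : ∀ z : sphere (0 : En n) 1, (μH[d] : Measure (sphere (0 : En n) 1)) (ball z r)
      = μH[d] (ball z.1 r ∩ sphere (0 : En n) 1) := by
    intro z
    rw [← (isometry_subtype_coe (s := sphere (0 : En n) 1)).hausdorffMeasure_image (Or.inl hd)]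
    rw [Subtype.image_ball]; rfl
  rw [h1, h1, ← L.toIsometryEquiv.hausdorffMeasure_image]
  congr 1
  rw [image_inter L.toIsometryEquiv.injective]
  have e1 : L.toIsometryEquiv '' ball x.1 r = ball y.1 r := by
    rw [IsometryEquiv.image_ball]; simp [hL]
  have e2 : L.toIsometryEquiv '' sphere 0 1 = sphere 0 1 := by
    rw [IsometryEquiv.image_sphere]; simp
  exact congrArg₂ _ e1 e2

theorem sphere_hausdorff_lt_top (m : ℕ) : (μH[(m : ℝ)] : Measure (En (m+1))) (sphere 0 1) < ⊤ := by
  let w : Fin (m+1) → ℝ → (Fin m → ℝ) → En (m+1) := fun i s u =>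
    WithLp.toLp 2 (Fin.insertNth (α := fun _ => ℝ) i s u)
  let g : Fin (m+1) → ℝ → (Fin m → ℝ) → En (m+1) := fun i s u => ‖w i s u‖⁻¹ • w i s u
  have hw : ∀ i s, ContDiff ℝ 1 (w i s) := by
    intro i s
    apply contDiff_euclidean.2
    intro j
    simp only [w]
    rcases Fin.eq_self_or_eq_succAbove i j with h | ⟨k, hk⟩
    · subst h
      simp only [Fin.insertNth_apply_same]
      fun_prop
    · subst hk
      simp only [Fin.insertNth_apply_succAbove]
      fun_prop
  have hg : ∀ i s, s ≠ 0 → (μH[(m : ℝ)] : Measure (En (m+1))) (g i s '' closedBall 0 1) < ⊤ := by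
    intro i s hs
    have hne : ∀ u, w i s u ≠ 0 := by
      intro u h
      have := congrArg (fun v : En (m+1) => v i) h
      simp [w] at this
      exact hs this
    have hc : ContDiff ℝ 1 (g i s) := by
      have h1 : ContDiff ℝ 1 (fun u => ‖w i s u‖⁻¹) := by
        exact ((hw i s).norm ℝ hne).inv (fun u => norm_ne_zero_iff.2 (hne u))
      exact h1.smul (hw i s)
    obtain ⟨K, hK⟩ := (hc.contDiffOn (s := closedBall 0 1)).exists_lipschitzOnWith one_ne_zero
      (convex_closedBall 0 1) (isCompact_closedBall 0 1)
    refine (hK.hausdorffMeasure_image_le (d := m) (by positivity)).trans_lt ?_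
    have : (μH[(m : ℝ)] : Measure (Fin m → ℝ)) = volume := by
      rw [← hausdorffMeasure_pi_real, Fintype.card_fin]
    rw [this]
    apply ENNReal.mul_lt_top
    · exact ENNReal.rpow_lt_top_of_nonneg (by positivity) ENNReal.coe_ne_top
    · exact measure_closedBall_lt_top
  have hsub : sphere (0 : En (m+1)) 1 ⊆ ⋃ i, (g i 1 '' closedBall 0 1 ∪ g i (-1) '' closedBall 0 1) := by
    intro x hx
    obtain ⟨i, hi⟩ := Finite.exists_max (fun j => |x j|)
    have hx0 : x ≠ 0 := by
      rintro rfl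
      simp at hx
    have hxi : 0 < |x i| := by
      rw [abs_pos]
      intro h
      apply hx0
      ext j
      have := hi j
      simp only [h, abs_zero] at this
      simpa using this
    have hxn : ‖x‖ = 1 := by simpa using hx
    let u : Fin m → ℝ := fun k => |x i|⁻¹ * x (i.succAbove k)
    have hu : u ∈ closedBall (0 : Fin m → ℝ) 1 := by
      rw [mem_closedBall, dist_zero_right, pi_norm_le_iff_of_nonneg zero_le_one]
      intro k
      simp only [u, norm_mul, norm_inv, Real.norm_eq_abs, abs_abs]
      rw [inv_mul_le_iff₀ hxi, mul_one]
      exact hi _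
    have hwx : w i (|x i|⁻¹ * x i) u = |x i|⁻¹ • x := by
      ext j
      simp only [w]
      rcases Fin.eq_self_or_eq_succAbove i j with h | ⟨k, hk⟩
      · subst h
        simp
      · subst hk
        simp [u]
    have hgx : g i (|x i|⁻¹ * x i) u = x := by
      simp only [g, hwx, norm_smul, hxn, norm_inv, Real.norm_eq_abs, abs_abs]
      rw [smul_smul]
      simp [hxi.ne']
    rw [mem_iUnion]
    refine ⟨i, ?_⟩
    rcases lt_or_gt_of_ne (abs_pos.1 hxi) with h | h
    · right
      refine ⟨u, hu, ?_⟩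
      have : |x i|⁻¹ * x i = -1 := by
        rw [abs_of_neg h, inv_neg, neg_mul, inv_mul_cancel₀ h.ne]
      rw [← this]; exact hgx
    · left
      refine ⟨u, hu, ?_⟩
      have : |x i|⁻¹ * x i = 1 := by
        rw [abs_of_pos h]; field_simp
      rw [← this]; exact hgx
  refine (measure_mono hsub).trans_lt ?_
  refine (measure_iUnion_fintype_le _ _).trans_lt ?_
  rw [ENNReal.sum_lt_top]
  intro i _
  exact (measure_union_le _ _).trans_lt (ENNReal.add_lt_top.2 ⟨hg i 1 one_ne_zero, hg i (-1) (by norm_num)⟩)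

theorem sphere_hausdorff_pos (m : ℕ) : 0 < (μH[(m : ℝ)] : Measure (En (m+1))) (sphere 0 1) := by
  let p : En (m+1) → (Fin m → ℝ) := fun x k => x (Fin.castSucc k)
  have hp : LipschitzWith 1 p := by
    apply LipschitzWith.of_dist_le_mul
    intro x y
    rw [NNReal.coe_one, one_mul, dist_pi_le_iff dist_nonneg]
    intro k
    rw [dist_eq_norm, dist_eq_norm]
    exact PiLp.norm_apply_le (x - y) (Fin.castSucc k)
  have h1 := hp.hausdorffMeasure_image_le (d := m) (by positivity) (sphere 0 1)
  have : (μH[(m : ℝ)] : Measure (Fin m → ℝ)) = volume := by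
    rw [← hausdorffMeasure_pi_real, Fintype.card_fin]
  rw [this] at h1
  simp only [ENNReal.coe_one, ENNReal.one_rpow, one_mul] at h1
  refine lt_of_lt_of_le ?_ h1
  have hsub : {u : Fin m → ℝ | ∑ i, u i ^ 2 < 1} ⊆ p '' sphere 0 1 := by
    intro u hu
    have hu' : ∑ i, u i ^ 2 < 1 := hu
    refine ⟨WithLp.toLp 2 (Fin.snoc (α := fun _ => ℝ) u (√(1 - ∑ i, u i ^ 2))), ?_, ?_⟩
    · rw [mem_sphere_iff_norm, sub_zero, EuclideanSpace.norm_eq]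
      simp only [Fin.sum_univ_castSucc, Fin.snoc_castSucc, Fin.snoc_last, Real.norm_eq_abs, sq_abs]
      rw [Real.sq_sqrt (by linarith)]
      simp
    · ext k
      simp [p]
  refine lt_of_lt_of_le ?_ (measure_mono hsub)
  apply IsOpen.measure_pos
  · exact isOpen_lt (by fun_prop) (by fun_prop)
  · exact ⟨0, by simp⟩

theorem toSphere_integral_zero {n : ℕ} (hn : 0 < n) (ω : En n → ℝ)
    (hω : ContinuousOn ω {(0 : En n)}ᶜ)
    (h0 : (∫ ξ in sphere (0 : En n) 1, ω ξ ∂μH[(n : ℝ) - 1]) = 0) :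
    ∫ θ : sphere (0 : En n) 1, ω θ ∂(volume : Measure (En n)).toSphere = 0 := by
  obtain ⟨m, rfl⟩ : ∃ m, n = m + 1 := ⟨n - 1, by omega⟩
  have hd : ((m + 1 : ℕ) : ℝ) - 1 = m := by push_cast; ring
  rw [hd] at h0
  have hm : (0 : ℝ) ≤ m := by positivity
  have hiso := isometry_subtype_coe (s := sphere (0 : En (m+1)) 1)
  have htot : (μH[(m : ℝ)] : Measure (sphere (0 : En (m+1)) 1)) univ
      = μH[(m : ℝ)] (sphere (0 : En (m+1)) 1) := by
    rw [← hiso.hausdorffMeasure_image (Or.inl hm)]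
    rw [image_univ, Subtype.range_coe]
  have : IsFiniteMeasure (μH[(m : ℝ)] : Measure (sphere (0 : En (m+1)) 1)) :=
    ⟨by rw [htot]; exact sphere_hausdorff_lt_top m⟩
  apply uniq_aux (μH[(m : ℝ)] : Measure (sphere (0 : En (m+1)) 1))
  · intro r _ x y
    exact hausdorff_ball_eq _ r hm x y
  · intro r _ x y
    exact toSphere_ball_eq r x y
  · intro r hr x
    rw [pos_iff_ne_zero]
    intro hz
    have hall : ∀ y : sphere (0 : En (m+1)) 1, (μH[(m : ℝ)] : Measure _) (ball y r) = 0 := by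
      intro y
      rw [hausdorff_ball_eq _ r hm y x, hz]
    have : (μH[(m : ℝ)] : Measure (sphere (0 : En (m+1)) 1)) univ = 0 := by
      apply measure_null_of_locally_null
      intro y _
      exact ⟨ball y r, mem_nhdsWithin_of_mem_nhds (ball_mem_nhds _ hr), hall y⟩
    rw [htot] at this
    exact (sphere_hausdorff_pos m).ne' this
  · apply hω.comp_continuous continuous_subtype_val
    intro x
    have := x.2
    simp only [mem_compl_iff, mem_singleton_iff]
    intro h
    rw [h] at this
    simp at this
  · have hmap := hiso.map_hausdorffMeasure (d := m) (Or.inl hm)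
    rw [Subtype.range_coe] at hmap
    rw [← hmap, (MeasurableEmbedding.subtype_coe isClosed_sphere.measurableSet).integral_map] at h0
    exact h0

theorem polar_integral {n : ℕ} (hn : 0 < n) (F : En n → ℝ) (hF : Integrable F) :
    ∫ x, F x = ∫ θ : sphere (0 : En n) 1, (∫ r in Ioi (0 : ℝ), r ^ (n - 1) * F (r • θ.1))
      ∂(volume : Measure (En n)).toSphere := by
  have : Nontrivial (En n) := by
    have : Nonempty (Fin n) := ⟨⟨0, hn⟩⟩
    infer_instance
  have hdim : Module.finrank ℝ (En n) = n := by simp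
  have mp := (volume : Measure (En n)).measurePreserving_homeomorphUnitSphereProd
  rw [hdim] at mp
  let G : sphere (0 : En n) 1 × Ioi (0 : ℝ) → ℝ := fun q => F (q.2.1 • q.1.1)
  have hG : ∀ x : ({0}ᶜ : Set (En n)), G (homeomorphUnitSphereProd (En n) x) = F x.1 := by
    intro x
    simp only [G]
    congr 1
    have hx : ‖x.1‖ ≠ 0 := norm_ne_zero_iff.2 x.2
    simp only [homeomorphUnitSphereProd_apply_fst_coe, homeomorphUnitSphereProd_apply_snd_coe]
    rw [smul_smul, mul_inv_cancel₀ hx, one_smul]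
  have hGi : Integrable G ((volume : Measure (En n)).toSphere.prod (Measure.volumeIoiPow (n - 1))) := by
    rw [← mp.integrable_comp_emb (Homeomorph.measurableEmbedding _)]
    have : G ∘ (homeomorphUnitSphereProd (En n)) = F ∘ Subtype.val := by
      ext x; exact hG x
    rw [this, ← integrableOn_iff_comap_subtypeVal (by measurability)]
    exact hF.integrableOn
  calc ∫ x, F x = ∫ x : ({(0)}ᶜ : Set (En n)), F x.1 ∂((volume : Measure (En n)).comap (↑)) := by
        rw [integral_subtype_comap (measurableSet_singleton _).compl, restrict_compl_singleton]
    _ = ∫ q, G q ∂((volume : Measure (En n)).toSphere.prod (Measure.volumeIoiPow (n - 1))) := by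
        rw [← mp.integral_comp (Homeomorph.measurableEmbedding _)]
        simp_rw [hG]
    _ = _ := by
        rw [integral_prod _ hGi]
        congr 1
        ext θ
        simp only [Measure.volumeIoiPow, ENNReal.ofReal, G]
        rw [integral_withDensity_eq_integral_smul,
          integral_subtype_comap measurableSet_Ioi
            fun a ↦ Real.toNNReal (a ^ (n - 1)) • F (a • θ.1),
          setIntegral_congr_fun measurableSet_Ioi fun x hx ↦ ?_]
        · rw [NNReal.smul_def, Real.coe_toNNReal _ (pow_nonneg hx.out.le _), smul_eq_mul]
        · exact (measurable_subtype_coe.pow_const _).real_toNNReal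

theorem ray_mem_ball {n : ℕ} (p θ : En n) (hθ : ‖θ‖ = 1) (R δ : ℝ) (hδ : 0 < δ)
    (hR : ‖p‖ + δ < R) (r : ℝ) (hr : 0 < r) :
    (r • θ ∈ ball p R ↔ r < inner ℝ θ p + √((inner ℝ θ p) ^ 2 + (R ^ 2 - ‖p‖ ^ 2))) ∧
    δ < inner ℝ θ p + √((inner ℝ θ p) ^ 2 + (R ^ 2 - ‖p‖ ^ 2)) := by
  set b : ℝ := inner ℝ θ p with hb
  have hbp : |b| ≤ ‖p‖ := by
    have := abs_real_inner_le_norm θ p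
    rwa [hθ, one_mul] at this
  have hp := norm_nonneg p
  have hRp : 0 < R ^ 2 - ‖p‖ ^ 2 := by nlinarith
  set s := √(b ^ 2 + (R ^ 2 - ‖p‖ ^ 2)) with hs
  have hs2 : s ^ 2 = b ^ 2 + (R ^ 2 - ‖p‖ ^ 2) := Real.sq_sqrt (by positivity)
  have hs0 : 0 ≤ s := Real.sqrt_nonneg _
  have hsb : |b| < s := by
    apply abs_lt_of_sq_lt_sq _ hs0
    linarith
  have hbb := abs_lt.1 hsb
  constructor
  · rw [mem_ball_iff_norm]
    have h1 : ‖r • θ - p‖ ^ 2 = (r - b) ^ 2 - b ^ 2 + ‖p‖ ^ 2 := by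
      rw [norm_sub_sq_real, norm_smul, hθ, real_inner_smul_left, ← hb, Real.norm_eq_abs, mul_one, sq_abs]
      ring
    have hRpos : 0 < R := by linarith
    constructor
    · intro h
      have : ‖r • θ - p‖ ^ 2 < R ^ 2 := by gcongr
      have : (r - b) ^ 2 < s ^ 2 := by linarith
      have := abs_lt_of_sq_lt_sq this hs0
      linarith [(abs_lt.1 this).2]
    · intro h
      have h2 : |r - b| < s := abs_lt.2 ⟨by linarith, by linarith⟩
      have h3 : (r - b) ^ 2 < s ^ 2 := by
        apply sq_lt_sq' <;> linarith [(abs_lt.1 h2).1]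
      apply lt_of_pow_lt_pow_left₀ 2 hRpos.le
      linarith
  · have h2 : (δ - b) ^ 2 < s ^ 2 := by
      have := abs_le.1 hbp
      nlinarith
    have := abs_lt_of_sq_lt_sq h2 hs0
    linarith [(abs_lt.1 this).2]

/-- kernel hypotheses -/
structure IsKer (n : ℕ) (K : En n → ℝ) (M : ℝ) : Prop where
  meas : Measurable K
  even : ∀ x, x ≠ 0 → K (-x) = K x
  homog : ∀ t : ℝ, 0 < t → ∀ x, x ≠ 0 → K (t • x) = K x / t ^ n
  bound : ∀ x, x ≠ 0 → |K x| * ‖x‖ ^ n ≤ M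
  mean : ∫ θ : sphere (0 : En n) 1, K θ ∂(volume : Measure (En n)).toSphere = 0

theorem IsKer.nonneg {n : ℕ} {K : En n → ℝ} {M : ℝ} (h : IsKer n K M) (hn : 0 < n) : 0 ≤ M := by
  have : Nontrivial (En n) := by
    have : Nonempty (Fin n) := ⟨⟨0, hn⟩⟩
    infer_instance
  obtain ⟨x, hx⟩ := exists_ne (0 : En n)
  exact le_trans (by positivity) (h.bound x hx)

theorem IsKer.le_of {n : ℕ} {K : En n → ℝ} {M : ℝ} (h : IsKer n K M) {x : En n} (hx : x ≠ 0) :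
    |K x| ≤ M * ‖x‖ ^ (-(n : ℝ)) := by
  have hx' : 0 < ‖x‖ := norm_pos_iff.2 hx
  rw [Real.rpow_neg hx'.le, Real.rpow_natCast, ← div_eq_mul_inv, le_div_iff₀ (by positivity)]
  exact h.bound x hx

theorem ker_integrable {n : ℕ} (hn : 0 < n) {K : En n → ℝ} {M : ℝ} (h : IsKer n K M)
    (A : Set (En n)) (hA : MeasurableSet A) (hAf : volume A < ⊤) (δ : ℝ) (hδ : 0 < δ)
    (hAδ : ∀ y ∈ A, δ ≤ ‖y‖) : IntegrableOn K A := by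
  have hM := h.nonneg hn
  apply IntegrableOn.of_bound hAf h.meas.aestronglyMeasurable (M * δ ^ (-(n:ℝ)))
  filter_upwards [ae_restrict_mem hA] with y hy
  have h1 := hAδ y hy
  have hy0 : y ≠ 0 := norm_pos_iff.1 (by linarith)
  refine (h.le_of hy0).trans ?_
  apply mul_le_mul_of_nonneg_left _ hM
  exact Real.rpow_le_rpow_of_nonpos hδ h1 (by simp)

theorem ball_lemma {n : ℕ} (hn : 0 < n) {K : En n → ℝ} {M : ℝ} (h : IsKer n K M)
    (p : En n) (R δ : ℝ) (hδ : 0 < δ) (hR : ‖p‖ + δ < R) :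
    ∫ y in ball p R ∩ {y | δ < ‖y‖}, K y = 0 := by
  set A := ball p R ∩ {y : En n | δ < ‖y‖} with hAdef
  have hA : MeasurableSet A :=
    measurableSet_ball.inter (isOpen_lt (by fun_prop) (by fun_prop)).measurableSet
  have hFi : Integrable (A.indicator K) := by
    rw [integrable_indicator_iff hA]
    apply ker_integrable hn h A hA _ δ hδ (fun y hy => (le_of_lt hy.2))
    exact (measure_mono inter_subset_left).trans_lt measure_ball_lt_top
  rw [← integral_indicator hA]
  set F := A.indicator K with hF
  have hFi' : Integrable (fun y => F (-y)) := hFi.comp_neg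
  have e1 : 2 * ∫ y, F y = ∫ y, (F y + F (-y)) := by
    rw [integral_add hFi hFi', integral_neg_eq_self]; ring
  have e2 : ∫ y, (F y + F (-y)) = 0 := by
    rw [polar_integral hn (fun y => F y + F (-y)) (hFi.add hFi')]
    have e3 : ∀ θ : sphere (0 : En n) 1, (∫ r in Ioi (0 : ℝ), r ^ (n - 1) * (F (r • θ.1) + F (-(r • θ.1))))
        = K θ * Real.log ((R ^ 2 - ‖p‖ ^ 2) / δ ^ 2) := by
      intro θ
      have hθ : ‖θ.1‖ = 1 := by simp
      have hθ' : ‖-θ.1‖ = 1 := by simp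
      have hθ0 : θ.1 ≠ 0 := by
        intro h0; rw [h0] at hθ; simp at hθ
      set b : ℝ := inner ℝ θ.1 p with hb
      have hb' : inner ℝ (-θ.1) p = -b := by rw [inner_neg_left]
      set s := √(b ^ 2 + (R ^ 2 - ‖p‖ ^ 2)) with hs
      have hp := norm_nonneg p
      have hRp : 0 < R ^ 2 - ‖p‖ ^ 2 := by nlinarith
      have hs2 : s ^ 2 = b ^ 2 + (R ^ 2 - ‖p‖ ^ 2) := Real.sq_sqrt (by positivity)
      have k1 := fun r hr => ray_mem_ball p θ.1 hθ R δ hδ hR r hr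
      have k2 := fun r hr => ray_mem_ball p (-θ.1) hθ' R δ hδ hR r hr
      simp only [hb', neg_sq, ← hb, ← hs] at k1 k2
      have hF1 : ∀ φ : En n, ‖φ‖ = 1 → ∀ r : ℝ, 0 < r → ∀ c : ℝ, (r • φ ∈ ball p R ↔ r < c) →
          K φ = K θ → r ^ (n - 1) * F (r • φ) = (Ioo δ c).indicator (fun r => K θ * r⁻¹) r := by
        intro φ hφ r hr c hc hK
        have hφ0 : φ ≠ 0 := by
          intro h0; rw [h0] at hφ; simp at hφ
        have hn' : ‖r • φ‖ = r := by rw [norm_smul, hφ, mul_one, Real.norm_eq_abs, abs_of_pos hr]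
        have hiff : r • φ ∈ A ↔ r ∈ Ioo δ c := by
          rw [hAdef, mem_inter_iff, hc, mem_ofPred_eq, hn', mem_Ioo, and_comm]
        by_cases hmem : r ∈ Ioo δ c
        · rw [hF, indicator_of_mem (hiff.2 hmem), indicator_of_mem hmem, h.homog r hr φ hφ0, hK]
          have : r ^ n = r ^ (n - 1) * r := by
            rw [← pow_succ, Nat.sub_add_cancel hn]
          rw [this]
          field_simp
        · rw [hF, indicator_of_notMem (fun hh => hmem (hiff.1 hh)), indicator_of_notMem hmem, mul_zero]
      have e4 : ∀ r ∈ Ioi (0:ℝ), r ^ (n - 1) * (F (r • θ.1) + F (-(r • θ.1))) =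
          (Ioo δ (b + s)).indicator (fun r => K θ * r⁻¹) r +
          (Ioo δ (-b + s)).indicator (fun r => K θ * r⁻¹) r := by
        intro r hr
        rw [mul_add, ← smul_neg, hF1 θ.1 hθ r hr (b + s) (k1 r hr).1 rfl,
          hF1 (-θ.1) hθ' r hr (-b + s) (k2 r hr).1 (h.even _ hθ0)]
      rw [setIntegral_congr_fun measurableSet_Ioi e4]
      have hIntB : ∀ c, δ < c → IntegrableOn (fun r : ℝ => K θ * r⁻¹) (Ioo δ c) := by
        intro c hc
        have : ContinuousOn (fun r : ℝ => K θ * r⁻¹) (Icc δ c) := by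
          apply ContinuousOn.mul continuousOn_const
          apply continuousOn_inv₀.mono
          intro r hr
          simp only [mem_compl_iff, mem_singleton_iff]
          linarith [hr.1]
        exact this.integrableOn_Icc.mono_set Ioo_subset_Icc_self
      have hval : ∀ c, δ < c → ∫ r in Ioi (0:ℝ), (Ioo δ c).indicator (fun r => K θ * r⁻¹) r
          = K θ * Real.log (c / δ) := by
        intro c hc
        rw [setIntegral_indicator measurableSet_Ioo]
        have : Ioi (0:ℝ) ∩ Ioo δ c = Ioo δ c := by
          apply inter_eq_self_of_subset_right
          intro r hr
          exact lt_trans hδ hr.1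
        rw [this, ← integral_Ioc_eq_integral_Ioo, ← intervalIntegral.integral_of_le hc.le,
          intervalIntegral.integral_const_mul, integral_inv_of_pos hδ (lt_trans hδ hc)]
      have d1 := (k1 1 one_pos).2
      have d2 := (k2 1 one_pos).2
      rw [integral_add, hval _ d1, hval _ d2, ← mul_add, ← Real.log_mul]
      · congr 2
        have : R ^ 2 - ‖p‖ ^ 2 = (b + s) * (-b + s) := by nlinarith
        rw [this]
        field_simp
      · have : 0 < (b + s) / δ := div_pos (by linarith) hδ
        exact this.ne'
      · have : 0 < (-b + s) / δ := div_pos (by linarith) hδ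
        exact this.ne'
      · exact ((integrable_indicator_iff measurableSet_Ioo).2 (hIntB _ d1)).integrableOn
      · exact ((integrable_indicator_iff measurableSet_Ioo).2 (hIntB _ d2)).integrableOn
    simp_rw [e3]
    rw [integral_mul_const, h.mean, zero_mul]
  linarith

theorem shell_bound {n : ℕ} (S : Set (En n)) (hS : MeasurableSet S) (x : En n) (C α β a b : ℝ)
    (hβ : 0 ≤ β) (ha : 0 < a) (hb : 0 < b)
    (hvol : ∀ r > 0, volume (S ∩ ball x r) ≤ ENNReal.ofReal (C * r ^ α)) :
    ∫⁻ y in (S ∩ ball x b) \ ball x a, ENNReal.ofReal (‖y - x‖ ^ (-β)) ≤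
      ENNReal.ofReal (a ^ (-β) * (C * b ^ α)) := by
  calc ∫⁻ y in (S ∩ ball x b) \ ball x a, ENNReal.ofReal (‖y - x‖ ^ (-β))
      ≤ ∫⁻ y in (S ∩ ball x b) \ ball x a, ENNReal.ofReal (a ^ (-β)) := by
        apply setLIntegral_mono' ((hS.inter measurableSet_ball).diff measurableSet_ball)
        intro y hy
        apply ENNReal.ofReal_le_ofReal
        have h2 : a ≤ ‖y - x‖ := by
          have := hy.2
          rwa [mem_ball_iff_norm, not_lt] at this
        exact Real.rpow_le_rpow_of_nonpos ha h2 (by linarith)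
    _ = ENNReal.ofReal (a ^ (-β)) * volume ((S ∩ ball x b) \ ball x a) := by
        rw [setLIntegral_const]
    _ ≤ ENNReal.ofReal (a ^ (-β)) * ENNReal.ofReal (C * b ^ α) := by
        gcongr
        exact (measure_mono sdiff_subset).trans (hvol b hb)
    _ = _ := by rw [← ENNReal.ofReal_mul (by positivity)]

theorem geom_cover {X : Type*} [MeasurableSpace X] {μ : Measure X} (g : X → ℝ≥0∞) (T : Set X)
    (Tk : ℕ → Set X) (hT : T ⊆ ⋃ k, Tk k) (a q : ℝ) (ha : 0 ≤ a) (hq0 : 0 ≤ q) (hq : q < 1)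
    (h : ∀ k, ∫⁻ y in Tk k, g y ∂μ ≤ ENNReal.ofReal (a * q ^ k)) :
    ∫⁻ y in T, g y ∂μ ≤ ENNReal.ofReal (a * (1 - q)⁻¹) := by
  calc ∫⁻ y in T, g y ∂μ ≤ ∫⁻ y in ⋃ k, Tk k, g y ∂μ := lintegral_mono_set hT
    _ ≤ ∑' k, ∫⁻ y in Tk k, g y ∂μ := lintegral_iUnion_le _ _
    _ ≤ ∑' k, ENNReal.ofReal (a * q ^ k) := ENNReal.tsum_le_tsum h
    _ = ENNReal.ofReal (∑' k, a * q ^ k) := by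
        rw [ENNReal.ofReal_tsum_of_nonneg (fun k => by positivity)]
        exact (summable_geometric_of_lt_one hq0 hq).mul_left a
    _ = _ := by rw [tsum_mul_left, tsum_geometric_of_lt_one hq0 hq]

/-- inner integral bound -/
theorem near_bound {n : ℕ} (S : Set (En n)) (hS : MeasurableSet S) (x : En n) (C α β D : ℝ)
    (hC : 0 ≤ C) (hβ : 0 < β) (hαβ : β < α) (hD : 0 < D)
    (hvol : ∀ r > 0, volume (S ∩ ball x r) ≤ ENNReal.ofReal (C * r ^ α)) :
    ∫⁻ y in S ∩ ball x D, ENNReal.ofReal (‖y - x‖ ^ (-β)) ≤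
      ENNReal.ofReal (C * 2 ^ β * (1 - 2 ^ (β - α))⁻¹ * D ^ (α - β)) := by
  have h2 : (0:ℝ) < 2 := by norm_num
  have hmain : ∫⁻ y in (S ∩ ball x D) \ {x}, ENNReal.ofReal (‖y - x‖ ^ (-β)) ≤
      ENNReal.ofReal (C * 2 ^ β * D ^ (α - β) * (1 - 2 ^ (β - α))⁻¹) := by
    apply geom_cover _ _ (fun k => (S ∩ ball x (D * (1/2) ^ k)) \ ball x (D * (1/2) ^ (k+1)))
    · intro y hy
      have hyx : 0 < ‖y - x‖ / D := by
        have : y - x ≠ 0 := sub_ne_zero.2 hy.2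
        positivity
      have hyD : ‖y - x‖ / D < 1 := by
        rw [div_lt_one hD]; exact mem_ball_iff_norm.1 hy.1.2
      obtain ⟨k, hk1, hk2⟩ := exists_nat_pow_near_of_lt_one hyx hyD.le
        (by norm_num : (0:ℝ) < 1/2) (by norm_num)
      rw [mem_iUnion]
      rw [lt_div_iff₀ hD] at hk1
      rw [div_le_iff₀ hD] at hk2
      rcases hk2.lt_or_eq with hlt | heq
      · refine ⟨k, ⟨hy.1.1, ?_⟩, ?_⟩
        · rw [mem_ball_iff_norm]; linarith
        · rw [mem_ball_iff_norm]; linarith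
      · have hk0 : k ≠ 0 := by
          rintro rfl
          simp at heq
          rw [heq, div_self hD.ne'] at hyD
          exact lt_irrefl _ hyD
        obtain ⟨j, rfl⟩ := Nat.exists_eq_succ_of_ne_zero hk0
        refine ⟨j, ⟨hy.1.1, ?_⟩, ?_⟩
        · rw [mem_ball_iff_norm, heq, Nat.succ_eq_add_one, pow_succ]
          have : 0 < (1/2:ℝ)^j := by positivity
          nlinarith [mul_pos this hD]
        · rw [mem_ball_iff_norm, heq, Nat.succ_eq_add_one, mul_comm]
          exact lt_irrefl _
    · positivity
    · positivity
    · exact Real.rpow_lt_one_of_one_lt_of_neg (by norm_num) (by linarith)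
    · intro k
      refine (shell_bound S hS x C α β _ _ hβ.le (by positivity) (by positivity) hvol).trans ?_
      apply ENNReal.ofReal_le_ofReal
      apply le_of_eq
      have e1 : (1/2:ℝ) ^ k = 2 ^ (-(k:ℝ)) := by
        rw [Real.rpow_neg h2.le, Real.rpow_natCast, one_div, inv_pow]
      have e2 : (1/2:ℝ) ^ (k+1) = 2 ^ (-(k:ℝ) - 1) := by
        rw [pow_succ, e1, Real.rpow_sub h2, Real.rpow_one]; ring
      rw [e1, e2, Real.mul_rpow hD.le (by positivity), Real.mul_rpow hD.le (by positivity),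
        ← Real.rpow_mul h2.le, ← Real.rpow_mul h2.le, ← Real.rpow_natCast (2 ^ (β - α)),
        ← Real.rpow_mul h2.le]
      have e3 : D ^ (α - β) = D ^ (-β) * D ^ α := by rw [← Real.rpow_add hD]; ring_nf
      have e4 : (2:ℝ) ^ ((-(k:ℝ) - 1) * -β) * 2 ^ (-(k:ℝ) * α) = 2 ^ β * 2 ^ ((β - α) * (k:ℝ)) := by
        rw [← Real.rpow_add h2, ← Real.rpow_add h2]; ring_nf
      rw [e3]
      linear_combination (C * D ^ (-β) * D ^ α) * e4
  have hle : ∫⁻ y in S ∩ ball x D, ENNReal.ofReal (‖y - x‖ ^ (-β)) ≤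
      ∫⁻ y in (S ∩ ball x D) \ {x}, ENNReal.ofReal (‖y - x‖ ^ (-β)) := by
    rw [← lintegral_indicator (hS.inter measurableSet_ball),
      ← lintegral_indicator ((hS.inter measurableSet_ball).diff (measurableSet_singleton x))]
    apply lintegral_mono
    intro y
    by_cases hy : y = x
    · subst hy
      by_cases hm : y ∈ S ∩ ball y D
      · rw [indicator_of_mem hm, sub_self, norm_zero, Real.zero_rpow (by linarith)]
        simp
      · rw [indicator_of_notMem hm]; exact zero_le
    · by_cases hm : y ∈ S ∩ ball x D
      · rw [indicator_of_mem hm, indicator_of_mem (show y ∈ (S ∩ ball x D) \ {x} from ⟨hm, hy⟩)]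
      · rw [indicator_of_notMem hm]; exact zero_le
  refine (hle.trans hmain).trans (le_of_eq ?_)
  congr 1; ring

theorem far_bound {n : ℕ} (S : Set (En n)) (hS : MeasurableSet S) (x : En n) (C α β ρ : ℝ)
    (hC : 0 ≤ C) (hα : 0 ≤ α) (hαβ : α < β) (hρ : 0 < ρ)
    (hvol : ∀ r > 0, volume (S ∩ ball x r) ≤ ENNReal.ofReal (C * r ^ α)) :
    ∫⁻ y in S \ ball x ρ, ENNReal.ofReal (‖y - x‖ ^ (-β)) ≤
      ENNReal.ofReal (C * 2 ^ α * (1 - 2 ^ (α - β))⁻¹ * ρ ^ (α - β)) := by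
  have h2 : (0:ℝ) < 2 := by norm_num
  have hmain : ∫⁻ y in S \ ball x ρ, ENNReal.ofReal (‖y - x‖ ^ (-β)) ≤
      ENNReal.ofReal (C * 2 ^ α * ρ ^ (α - β) * (1 - 2 ^ (α - β))⁻¹) := by
    apply geom_cover _ _ (fun k => (S ∩ ball x (ρ * 2 ^ (k+1))) \ ball x (ρ * 2 ^ k))
    · intro y hy
      have hyx : 1 ≤ ‖y - x‖ / ρ := by
        rw [one_le_div hρ]
        have := hy.2
        rwa [mem_ball_iff_norm, not_lt] at this
      obtain ⟨k, hk1, hk2⟩ := exists_nat_pow_near hyx (by norm_num : (1:ℝ) < 2)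
      rw [mem_iUnion]
      rw [div_lt_iff₀ hρ] at hk2
      rw [le_div_iff₀ hρ] at hk1
      refine ⟨k, ⟨hy.1, ?_⟩, ?_⟩
      · rw [mem_ball_iff_norm]; linarith
      · rw [mem_ball_iff_norm]; linarith
    · positivity
    · positivity
    · exact Real.rpow_lt_one_of_one_lt_of_neg (by norm_num) (by linarith)
    · intro k
      refine (shell_bound S hS x C α β _ _ (by linarith) (by positivity) (by positivity) hvol).trans ?_
      apply ENNReal.ofReal_le_ofReal
      apply le_of_eq
      have e1 : (2:ℝ) ^ k = 2 ^ ((k:ℝ)) := by rw [Real.rpow_natCast]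
      have e2 : (2:ℝ) ^ (k+1) = 2 ^ ((k:ℝ) + 1) := by
        rw [pow_succ, e1, Real.rpow_add h2, Real.rpow_one]
      rw [e1, e2, Real.mul_rpow hρ.le (by positivity), Real.mul_rpow hρ.le (by positivity),
        ← Real.rpow_mul h2.le, ← Real.rpow_mul h2.le, ← Real.rpow_natCast (2 ^ (α - β)),
        ← Real.rpow_mul h2.le]
      have e3 : ρ ^ (α - β) = ρ ^ (-β) * ρ ^ α := by rw [← Real.rpow_add hρ]; ring_nf
      have e4 : (2:ℝ) ^ ((k:ℝ) * -β) * 2 ^ (((k:ℝ) + 1) * α) = 2 ^ α * 2 ^ ((α - β) * (k:ℝ)) := by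
        rw [← Real.rpow_add h2, ← Real.rpow_add h2]; ring_nf
      rw [e3]
      linear_combination (C * ρ ^ (-β) * ρ ^ α) * e4
  refine hmain.trans (le_of_eq ?_)
  congr 1; ring

theorem slab_volume {n : ℕ} (hn : 0 < n) (a ν : En n) (hν : ‖ν‖ = 1) (r h : ℝ) (hr : 0 ≤ r) (hh : 0 ≤ h) :
    volume {y ∈ ball a r | |inner ℝ ν (y - a)| ≤ h} ≤ ENNReal.ofReal (2 ^ n * h * r ^ (n - 1)) := by
  obtain ⟨m, rfl⟩ : ∃ m, n = m + 1 := ⟨n - 1, by omega⟩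
  obtain ⟨L, hL⟩ := sphere_trans (⟨ν, by simpa using hν⟩ : sphere (0 : En (m+1)) 1)
    ⟨EuclideanSpace.single 0 1, by simp⟩
  simp only at hL
  let lo : Fin (m+1) → ℝ := Fin.cons (-h) (fun _ => -r)
  let hi : Fin (m+1) → ℝ := Fin.cons h (fun _ => r)
  have hbox : volume ((fun z : En (m+1) => (z.ofLp : Fin (m+1) → ℝ)) ⁻¹' Icc lo hi)
      = ENNReal.ofReal (2 ^ (m+1) * h * r ^ m) := by
    rw [(PiLp.volume_preserving_ofLp (Fin (m+1))).measure_preimage measurableSet_Icc.nullMeasurableSet,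
      Real.volume_Icc_pi, Fin.prod_univ_succ]
    simp only [lo, hi, Fin.cons_zero, Fin.cons_succ, Finset.prod_const, Finset.card_univ, Fintype.card_fin]
    rw [← ENNReal.ofReal_pow (by linarith), ← ENNReal.ofReal_mul (by linarith)]
    congr 1
    ring
  have hsub : {y ∈ ball a r | |inner ℝ ν (y - a)| ≤ h} ⊆ (fun y => y - a) ⁻¹'
      (L ⁻¹' ((fun z : En (m+1) => (z.ofLp : Fin (m+1) → ℝ)) ⁻¹' Icc lo hi)) := by
    rintro y ⟨hy1, hy2⟩
    have h0 : (L (y - a)) 0 = inner ℝ ν (y - a) := by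
      rw [← L.inner_map_map, hL, EuclideanSpace.inner_single_left]
      simp
    have hi' : ∀ i, |(L (y - a)) i| ≤ r := by
      intro i
      have := PiLp.norm_apply_le (L (y - a)) i
      rw [L.norm_map] at this
      rw [mem_ball_iff_norm] at hy1
      exact this.trans hy1.le
    simp only [mem_preimage, mem_Icc, Pi.le_def]
    constructor
    · intro i
      refine Fin.cases ?_ (fun j => ?_) i
      · simp only [lo, Fin.cons_zero]; rw [h0]; exact (abs_le.1 hy2).1
      · simp only [lo, Fin.cons_succ]; exact (abs_le.1 (hi' _)).1
    · intro i
      refine Fin.cases ?_ (fun j => ?_) i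
      · simp only [hi, Fin.cons_zero]; rw [h0]; exact (abs_le.1 hy2).2
      · simp only [hi, Fin.cons_succ]; exact (abs_le.1 (hi' _)).2
  refine (measure_mono hsub).trans ?_
  have e1 : (fun y : En (m+1) => y - a) = fun y => y + (-a) := by funext y; exact sub_eq_add_neg y a
  rw [e1, measure_preimage_add_right]
  refine (L.measurePreserving.measure_preimage_equiv (f := L.toMeasurableEquiv) _).trans_le ?_
  rw [hbox]
  simp

/-- local defining function -/
theorem chart_fun {n : ℕ} {ε : ℝ} (hε0 : 0 < ε) {Ω : Set (En n)} (hΩ : HasC1HolderBoundary n ε Ω) (a : En n)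
    (ha : a ∈ frontier Ω) : ∃ r > 0, ∃ F : En n → ℝ, ∃ e : En n, ∃ c : ℝ, 0 ≤ c ∧ ‖e‖ = 1 ∧
      Differentiable ℝ F ∧ (∀ x y, ‖fderiv ℝ F x - fderiv ℝ F y‖ ≤ c * ‖x - y‖ ^ ε) ∧
      (∀ x, ∀ t : ℝ, F (x - t • e) = F x - t) ∧ ∀ x ∈ ball a r, (x ∈ Ω ↔ F x < 0) := by
  obtain ⟨hn, H⟩ := hΩ
  obtain ⟨r, hr, R, φ, hφ, ⟨c, hc⟩, hset⟩ := H a ha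
  set last : Fin n := ⟨n - 1, Nat.sub_lt hn Nat.one_pos⟩ with hlast
  let ℓ : En n →L[ℝ] ℝ := (EuclideanSpace.proj last : En n →L[ℝ] ℝ).comp
    (R.toContinuousLinearEquiv : En n →L[ℝ] En n)
  let P : En n →L[ℝ] (Fin (n-1) → ℝ) := ContinuousLinearMap.pi fun i =>
    (EuclideanSpace.proj (Fin.castLE (Nat.sub_le n 1) i) : En n →L[ℝ] ℝ).comp
    (R.toContinuousLinearEquiv : En n →L[ℝ] En n)
  let e : En n := R.symm (EuclideanSpace.single last 1)
  have hℓe : ℓ e = 1 := by simp [ℓ, e]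
  have hPe : P e = 0 := by
    ext i
    have : Fin.castLE (Nat.sub_le n 1) i ≠ last := by
      intro h
      have := congrArg Fin.val h
      simp [hlast] at this
      have := i.2
      omega
    simp [P, e, this]
  let F : En n → ℝ := fun x => ℓ x - φ (P x)
  have hφd : Differentiable ℝ φ := hφ.differentiable one_ne_zero
  have hFd : ∀ x, HasFDerivAt F (ℓ - (fderiv ℝ φ (P x)).comp P) x := by
    intro x
    exact ℓ.hasFDerivAt.sub ((hφd (P x)).hasFDerivAt.comp x P.hasFDerivAt)
  refine ⟨r, hr, F, e, c * ‖P‖ ^ ε * ‖P‖, by positivity, by simp [e], fun x => (hFd x).differentiableAt, ?_, ?_, ?_⟩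
  · intro x y
    rw [(hFd x).fderiv, (hFd y).fderiv, sub_sub_sub_cancel_left, ← ContinuousLinearMap.sub_comp]
    refine (ContinuousLinearMap.opNorm_comp_le _ _).trans ?_
    have h1 : ‖fderiv ℝ φ (P y) - fderiv ℝ φ (P x)‖ ≤ c * ‖P y - P x‖ ^ ε := by
      have := (holderOnWith_univ.1 hc).dist_le (P y) (P x)
      rwa [dist_eq_norm, dist_eq_norm, Real.coe_toNNReal _ hε0.le] at this
    have h2 : ‖P y - P x‖ ≤ ‖P‖ * ‖x - y‖ := by
      rw [← map_sub, norm_sub_rev x y]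
      exact P.le_opNorm _
    have h3 : ‖P y - P x‖ ^ ε ≤ ‖P‖ ^ ε * ‖x - y‖ ^ ε := by
      rw [← Real.mul_rpow (norm_nonneg _) (norm_nonneg _)]
      exact Real.rpow_le_rpow (norm_nonneg _) h2 hε0.le
    calc ‖fderiv ℝ φ (P y) - fderiv ℝ φ (P x)‖ * ‖P‖ ≤ (c * (‖P‖ ^ ε * ‖x - y‖ ^ ε)) * ‖P‖ := by
          gcongr; exact h1.trans (by gcongr)
      _ = _ := by ring
  · intro x t
    simp only [F, map_sub, map_smul, hℓe, hPe, smul_zero, sub_zero, smul_eq_mul, mul_one]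
    ring
  · intro x hx
    have h1 : x ∈ Ω ∩ ball a r ↔ x ∈ {x ∈ ball a r | R x last < φ fun i => R x (Fin.castLE (Nat.sub_le n 1) i)} := by
      rw [hset]
    have h2 : F x = R x last - φ fun i => R x (Fin.castLE (Nat.sub_le n 1) i) := rfl
    rw [h2, sub_neg]
    constructor
    · intro h; exact (h1.1 ⟨h, hx⟩).2
    · intro h; exact (h1.2 ⟨hx, h⟩).1

/-- uniform geometric data at a boundary point -/
def GeomAt {n : ℕ} (ε : ℝ) (Ω : Set (En n)) (s : ℝ) (a : En n) : Prop :=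
  (∃ ν : En n, ‖ν‖ = 1 ∧ ∀ y ∈ ball a s,
    (inner ℝ ν (y - a) < - (s⁻¹ * ‖y - a‖ ^ (1 + ε)) → y ∈ Ω) ∧
    (s⁻¹ * ‖y - a‖ ^ (1 + ε) < inner ℝ ν (y - a) → y ∉ Ω)) ∧
  (∃ e : En n, ‖e‖ = 1 ∧ ∀ x ∈ Ω, x ∈ ball a s → ∀ t, 0 < t → t < s → ball (x - t • e) (s * t) ⊆ Ω)

theorem GeomAt.mono {n : ℕ} {ε : ℝ} {Ω : Set (En n)} {s s' : ℝ} {a : En n} (h : GeomAt ε Ω s a)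
    (hs' : 0 < s') (hss : s' ≤ s) : GeomAt ε Ω s' a := by
  obtain ⟨⟨ν, hν, h1⟩, e, he, h2⟩ := h
  have hinv : s⁻¹ ≤ s'⁻¹ := by gcongr
  refine ⟨⟨ν, hν, fun y hy => ?_⟩, e, he, fun x hx hxa t ht hts => ?_⟩
  · have hle : s⁻¹ * ‖y - a‖ ^ (1 + ε) ≤ s'⁻¹ * ‖y - a‖ ^ (1 + ε) := by gcongr
    obtain ⟨k1, k2⟩ := h1 y (ball_subset_ball hss hy)
    exact ⟨fun h => k1 (by linarith), fun h => k2 (by linarith)⟩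
  · exact (ball_subset_ball (by gcongr)).trans
      (h2 x hx (ball_subset_ball hss hxa) t ht (by linarith))

theorem geom_local {n : ℕ} {ε : ℝ} (hε0 : 0 < ε) {Ω : Set (En n)} (hΩo : IsOpen Ω)
    (hΩ : HasC1HolderBoundary n ε Ω) (a : En n)
    (ha : a ∈ frontier Ω) : ∃ s > 0, ∀ a' ∈ frontier Ω, a' ∈ ball a s → GeomAt ε Ω s a' := by
  obtain ⟨r, hr, F, e, c, hc, he, hFd, hFh, hFe, hFΩ⟩ := chart_fun hε0 hΩ a ha
  set L := ‖fderiv ℝ F a‖ + c * r ^ ε with hL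
  have hLip : ∀ x ∈ ball a r, ∀ y ∈ ball a r, ‖F y - F x‖ ≤ L * ‖y - x‖ := by
    intro x hx y hy
    apply (convex_ball a r).norm_image_sub_le_of_norm_fderiv_le (𝕜 := ℝ) (fun z _ => hFd z) _ hx hy
    intro z hz
    have h1 := hFh z a
    have h2 : ‖z - a‖ ^ ε ≤ r ^ ε :=
      Real.rpow_le_rpow (norm_nonneg _) (mem_ball_iff_norm.1 hz).le hε0.le
    have h3 : ‖fderiv ℝ F z‖ ≤ ‖fderiv ℝ F a‖ + ‖fderiv ℝ F z - fderiv ℝ F a‖ := by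
      have := norm_add_le (fderiv ℝ F a) (fderiv ℝ F z - fderiv ℝ F a)
      rwa [add_sub_cancel] at this
    have : c * ‖z - a‖ ^ ε ≤ c * r ^ ε := by gcongr
    rw [hL]
    linarith
  have hL0 : 0 ≤ L := by positivity
  have hone : 0 < L + 1 + c := by positivity
  let s := min (r / 4) (min (L + 1 + c)⁻¹ 1)
  have hs : 0 < s := by positivity
  have hsr : s ≤ r / 4 := min_le_left _ _
  have hsL : s ≤ (L + 1 + c)⁻¹ := (min_le_right _ _).trans (min_le_left _ _)
  have hs1 : s ≤ 1 := (min_le_right _ _).trans (min_le_right _ _)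
  have hsL' : s * (L + 1 + c) ≤ 1 := by
    calc s * (L + 1 + c) ≤ (L + 1 + c)⁻¹ * (L + 1 + c) := by gcongr
      _ = 1 := inv_mul_cancel₀ hone.ne'
  have hcs : c ≤ s⁻¹ := by
    rw [← one_div, le_div_iff₀ hs]
    nlinarith
  refine ⟨s, hs, fun a' ha' ha's => ?_⟩
  have ha'r : ‖a' - a‖ < r / 4 := (mem_ball_iff_norm.1 ha's).trans_le hsr
  have hin : ∀ y, ‖y - a'‖ < 3 * r / 4 → y ∈ ball a r := by
    intro y hy
    rw [mem_ball_iff_norm]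
    have : ‖y - a‖ ≤ ‖y - a'‖ + ‖a' - a‖ := norm_sub_le_norm_sub_add_norm_sub _ _ _
    linarith
  have ha'b : a' ∈ ball a r := hin a' (by simp; linarith)
  have hF0 : F a' = 0 := by
    have hnot : a' ∉ Ω := by
      have := ha'
      rw [hΩo.frontier_eq] at this
      exact this.2
    have h1 : 0 ≤ F a' := by
      by_contra hlt
      push Not at hlt
      exact hnot ((hFΩ a' ha'b).2 hlt)
    by_contra hne
    have hpos : 0 < F a' := lt_of_le_of_ne h1 (Ne.symm hne)
    have hev : ∀ᶠ y in 𝓝 a', 0 < F y ∧ y ∈ ball a r :=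
      ((hFd.continuous.tendsto a').eventually (lt_mem_nhds hpos)).and (isOpen_ball.mem_nhds ha'b)
    have hfr : ∃ᶠ y in 𝓝 a', y ∈ Ω := mem_closure_iff_frequently.1 ha'.1
    obtain ⟨y, hyΩ, hy1, hy2⟩ := (hfr.and_eventually hev).exists
    have := (hFΩ y hy2).1 hyΩ
    linarith
  constructor
  · let g : En n := (InnerProductSpace.toDual ℝ (En n)).symm (fderiv ℝ F a')
    have hg : ∀ v, inner ℝ g v = fderiv ℝ F a' v := fun v => InnerProductSpace.toDual_symm_apply
    have hge : fderiv ℝ F a' e = 1 := by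
      have h1 : HasDerivAt (fun t : ℝ => F (a' - t • e)) (fderiv ℝ F a' (-e)) 0 := by
        have h2 : HasDerivAt (fun t : ℝ => a' - t • e) (-e) 0 := by
          simpa using ((hasDerivAt_id (0:ℝ)).smul_const e).const_sub a'
        have h3 : HasFDerivAt F (fderiv ℝ F a') (a' - (0:ℝ) • e) := by
          simpa using (hFd a').hasFDerivAt
        exact h3.comp_hasDerivAt (0:ℝ) h2
      have h4 : HasDerivAt (fun t : ℝ => F (a' - t • e)) (-1) 0 := by
        simp_rw [hFe]
        simpa using (hasDerivAt_id (0:ℝ)).const_sub (F a')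
      have := h1.unique h4
      rw [map_neg] at this
      linarith
    have hg1 : 1 ≤ ‖g‖ := by
      have := real_inner_le_norm g e
      rw [hg, hge, he, mul_one] at this
      exact this
    have hg0 : 0 < ‖g‖ := by linarith
    have hTaylor : ∀ y, |F y - inner ℝ g (y - a')| ≤ c * ‖y - a'‖ ^ (1 + ε) := by
      intro y
      have hh := (convex_closedBall a' ‖y - a'‖).norm_image_sub_le_of_norm_fderiv_le' (𝕜 := ℝ)
        (f := F) (φ := fderiv ℝ F a') (C := c * ‖y - a'‖ ^ ε) (x := a') (y := y)
        (fun z _ => hFd z) (fun z hz => ?_) (mem_closedBall_self (norm_nonneg _))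
        (by rw [mem_closedBall_iff_norm])
      · rw [hF0, sub_zero, ← hg, Real.norm_eq_abs] at hh
        refine hh.trans (le_of_eq ?_)
        rw [Real.rpow_add_of_nonneg (norm_nonneg _) zero_le_one hε0.le, Real.rpow_one]
        ring
      · refine (hFh z a').trans ?_
        gcongr
        exact mem_closedBall_iff_norm.1 hz
    refine ⟨‖g‖⁻¹ • g, by rw [norm_smul, norm_inv, norm_norm, inv_mul_cancel₀ hg0.ne'], fun y hy => ?_⟩
    have hyb : y ∈ ball a r := hin y (by
      have := mem_ball_iff_norm.1 hy
      linarith)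
    have hT := abs_le.1 (hTaylor y)
    set X := ‖y - a'‖ ^ (1 + ε) with hX
    have hX0 : 0 ≤ X := by positivity
    rw [real_inner_smul_left]
    have hin' : inner ℝ g (y - a') = ‖g‖ * (‖g‖⁻¹ * inner ℝ g (y - a')) := by
      rw [← mul_assoc, mul_inv_cancel₀ hg0.ne', one_mul]
    set Y := ‖g‖⁻¹ * inner ℝ g (y - a') with hY
    have hsX : c * X ≤ s⁻¹ * X := by gcongr
    have hsX0 : 0 ≤ s⁻¹ * X := by positivity
    constructor
    · intro h
      rw [hFΩ y hyb]
      nlinarith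
    · intro h
      rw [hFΩ y hyb, not_lt]
      nlinarith
  · refine ⟨e, he, fun x hx hxa t ht hts y hy => ?_⟩
    have hxa' := mem_ball_iff_norm.1 hxa
    have hy' := mem_ball_iff_norm.1 hy
    have hxb : x ∈ ball a r := hin x (by linarith)
    have hst : s * t ≤ t := by nlinarith
    have hte : ‖t • e‖ = t := by rw [norm_smul, he, mul_one, Real.norm_eq_abs, abs_of_pos ht]
    have h1b : ‖x - t • e - a'‖ ≤ ‖x - a'‖ + t := by
      have : x - t • e - a' = (x - a') - t • e := by abel
      rw [this]
      refine (norm_sub_le _ _).trans (by rw [hte])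
    have hxtb : x - t • e ∈ ball a r := hin _ (by linarith)
    have hyb : y ∈ ball a r := hin _ (by
      have : ‖y - a'‖ ≤ ‖y - (x - t • e)‖ + ‖x - t • e - a'‖ := norm_sub_le_norm_sub_add_norm_sub _ _ _
      linarith)
    rw [hFΩ y hyb]
    have h3 := hLip _ hxtb _ hyb
    rw [hFe] at h3
    have h4 := (hFΩ x hxb).1 hx
    have h5 := (abs_le.1 h3).2
    have h6 : L * ‖y - (x - t • e)‖ ≤ L * (s * t) := by gcongr
    have h7 : L * (s * t) ≤ t := by
      have : s * L ≤ 1 := by nlinarith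
      nlinarith
    linarith

theorem geom_uniform {n : ℕ} {ε : ℝ} (hε0 : 0 < ε) {Ω : Set (En n)} (hΩo : IsOpen Ω)
    (hΩb : Bornology.IsBounded Ω)
    (hΩ : HasC1HolderBoundary n ε Ω) : ∃ s > 0, s ≤ 1 ∧ ∀ a ∈ frontier Ω, GeomAt ε Ω s a := by
  have hcomp : IsCompact (frontier Ω) :=
    isCompact_of_isClosed_isBounded isClosed_frontier (hΩb.closure.subset frontier_subset_closure)
  have : ∃ s > 0, ∀ a ∈ frontier Ω, a ∈ frontier Ω → GeomAt ε Ω s a := by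
    refine hcomp.induction_on (p := fun S => ∃ s > 0, ∀ a ∈ S, a ∈ frontier Ω → GeomAt ε Ω s a) ?_ ?_ ?_ ?_
    · exact ⟨1, one_pos, by simp⟩
    · rintro S T hST ⟨s, hs, h⟩
      exact ⟨s, hs, fun a ha => h a (hST ha)⟩
    · rintro S T ⟨s, hs, h⟩ ⟨s', hs', h'⟩
      have hm : 0 < min s s' := lt_min hs hs'
      refine ⟨min s s', hm, ?_⟩
      rintro a (ha | ha) haf
      · exact (h a ha haf).mono hm (min_le_left _ _)
      · exact (h' a ha haf).mono hm (min_le_right _ _)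
    · intro a ha
      obtain ⟨s, hs, h⟩ := geom_local hε0 hΩo hΩ a ha
      exact ⟨ball a s, mem_nhdsWithin_of_mem_nhds (ball_mem_nhds _ hs), s, hs, fun a' h1 h2 => h a' h2 h1⟩
  obtain ⟨s, hs, h⟩ := this
  have hm : 0 < min s 1 := lt_min hs one_pos
  exact ⟨min s 1, hm, min_le_right _ _, fun a ha => (h a ha ha).mono hm (min_le_left _ _)⟩

theorem nearest_pt {n : ℕ} (hn : 0 < n) {Ω : Set (En n)} (hΩo : IsOpen Ω)
    (hΩb : Bornology.IsBounded Ω) (x : En n) (hx : x ∈ Ω) :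
    ∃ a ∈ frontier Ω, a ∉ Ω ∧ 0 < ‖x - a‖ ∧ ball x ‖x - a‖ ⊆ Ω := by
  have hne : (Ωᶜ).Nonempty := by
    by_contra hcon
    rw [not_nonempty_iff_eq_empty, compl_empty_iff] at hcon
    rw [hcon] at hΩb
    obtain ⟨m, rfl⟩ : ∃ m, n = m + 1 := ⟨n - 1, by omega⟩
    exact NormedSpace.unbounded_univ ℝ (En (m+1)) hΩb
  obtain ⟨a, ha, hd⟩ := hΩo.isClosed_compl.exists_infDist_eq_dist hne x
  have hsub : ball x ‖x - a‖ ⊆ Ω := by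
    intro y hy
    by_contra hyn
    have h1 := infDist_le_dist_of_mem (x := x) (show y ∈ Ωᶜ from hyn)
    rw [hd, dist_eq_norm] at h1
    rw [mem_ball, dist_comm] at hy
    linarith
  have hpos : 0 < ‖x - a‖ := by
    rw [norm_pos_iff, sub_ne_zero]
    rintro rfl
    exact ha hx
  refine ⟨a, ?_, ha, hpos, hsub⟩
  rw [frontier, Set.mem_sdiff, hΩo.interior_eq]
  refine ⟨closure_mono hsub ?_, ha⟩
  rw [closure_ball x hpos.ne']
  simp [mem_closedBall, dist_eq_norm, norm_sub_rev]

theorem normal_unique {n : ℕ} {ε : ℝ} (hε0 : 0 < ε) {Ω : Set (En n)} {s : ℝ} (hs : 0 < s) (a x ν : En n)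
    (hν : ‖ν‖ = 1) (hρ : 0 < ‖x - a‖) (hsub : ball x ‖x - a‖ ⊆ Ω)
    (h : ∀ y ∈ ball a s, s⁻¹ * ‖y - a‖ ^ (1 + ε) < inner ℝ ν (y - a) → y ∉ Ω) :
    x = a - ‖x - a‖ • ν := by
  set ρ := ‖x - a‖ with hρd
  set u : En n := ρ⁻¹ • (a - x) with hu
  have hun : ‖u‖ = 1 := by
    rw [hu, norm_smul, norm_inv, norm_sub_rev, ← hρd, Real.norm_of_nonneg hρ.le]
    field_simp
  have hax : a - x = ρ • u := by rw [hu, smul_smul, mul_inv_cancel₀ hρ.ne', one_smul]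
  by_cases hw : ν = u
  · rw [hw, ← hax]; abel
  exfalso
  set w : En n := ν - u with hwd
  have hw0 : 0 < ‖w‖ := by rw [norm_pos_iff, hwd, sub_ne_zero]; exact hw
  have hwu : ‖w‖ ^ 2 = 2 * (1 - inner ℝ ν u) := by
    rw [hwd, norm_sub_sq_real, hν, hun]; ring
  have hνw : inner ℝ ν w = ‖w‖ ^ 2 / 2 := by
    rw [hwu, hwd, inner_sub_right, real_inner_self_eq_norm_sq, hν]; ring
  have huw : inner ℝ u w = - (‖w‖ ^ 2 / 2) := by
    rw [hwu, hwd, inner_sub_right, real_inner_self_eq_norm_sq, hun, real_inner_comm]; ring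
  have key : ∀ t, 0 < t → t < ρ → t * ‖w‖ < s → ‖w‖ ^ 2 / 2 ≤ s⁻¹ * ‖w‖ ^ (1 + ε) * t ^ ε := by
    intro t ht htρ hts
    have hnt : ‖t • w‖ = t * ‖w‖ := by rw [norm_smul, Real.norm_of_nonneg ht.le]
    have hyΩ : a + t • w ∈ Ω := by
      apply hsub
      rw [mem_ball_iff_norm]
      have e1 : a + t • w - x = ρ • u + t • w := by rw [← hax]; abel
      rw [e1]
      have e2 : ‖ρ • u + t • w‖ ^ 2 = ρ ^ 2 - ρ * t * ‖w‖ ^ 2 + t ^ 2 * ‖w‖ ^ 2 := by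
        rw [norm_add_sq_real, hnt, norm_smul, Real.norm_of_nonneg hρ.le, hun, inner_smul_left, inner_smul_right, huw]
        simp; ring
      have e3 : ‖ρ • u + t • w‖ ^ 2 < ρ ^ 2 := by
        rw [e2]
        have : 0 < t * ‖w‖ ^ 2 * (ρ - t) := by
          have : 0 < ρ - t := by linarith
          positivity
        nlinarith
      exact lt_of_pow_lt_pow_left₀ 2 hρ.le e3
    by_contra hcon
    push Not at hcon
    refine h (a + t • w) ?_ ?_ hyΩ
    · rw [mem_ball_iff_norm, add_sub_cancel_left, hnt]; exact hts
    · rw [add_sub_cancel_left, hnt, inner_smul_right, hνw, Real.mul_rpow ht.le hw0.le, Real.rpow_add ht, Real.rpow_one]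
      calc s⁻¹ * (t * t ^ ε * ‖w‖ ^ (1 + ε)) = t * (s⁻¹ * ‖w‖ ^ (1 + ε) * t ^ ε) := by ring
        _ < _ := by gcongr
  have hlim : Tendsto (fun t : ℝ => s⁻¹ * ‖w‖ ^ (1 + ε) * t ^ ε) (𝓝[>] 0) (𝓝 0) := by
    have : ContinuousAt (fun t : ℝ => s⁻¹ * ‖w‖ ^ (1 + ε) * t ^ ε) 0 :=
      continuousAt_const.mul (Real.continuousAt_rpow_const 0 ε (Or.inr hε0.le))
    have := this.tendsto
    simp only [Real.zero_rpow hε0.ne', mul_zero] at this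
    exact this.mono_left nhdsWithin_le_nhds
  have hge : ‖w‖ ^ 2 / 2 ≤ 0 := by
    refine ge_of_tendsto hlim ?_
    have h1 : Iio (min ρ (s / ‖w‖)) ∈ 𝓝[>] (0:ℝ) :=
      mem_nhdsWithin_of_mem_nhds (Iio_mem_nhds (lt_min hρ (by positivity)))
    filter_upwards [h1, self_mem_nhdsWithin] with t ht1 ht2
    rw [mem_Iio, lt_min_iff, lt_div_iff₀ hw0] at ht1
    exact key t ht2 ht1.1 ht1.2
  have : 0 < ‖w‖ ^ 2 / 2 := by positivity
  linarith

/-- approximating ball at each interior point -/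
def ApproxBall {n : ℕ} (ε : ℝ) (Ω : Set (En n)) (C : ℝ) (x c : En n) (R : ℝ) : Prop :=
  (∀ ρ, ball x ρ ⊆ Ω → ball x ρ ⊆ ball c R) ∧
  (∀ r > 0, volume ((Ω \ ball c R ∪ ball c R \ Ω) ∩ ball x r) ≤ ENNReal.ofReal (C * r ^ (n + ε))) ∧
  (Ω \ ball c R ∪ ball c R \ Ω) ⊆ ball x C

theorem tangent_ball {n : ℕ} (hn : 0 < n) {ε : ℝ} (hε0 : 0 < ε) (hε1 : ε < 1) {Ω : Set (En n)} (hΩo : IsOpen Ω)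
    (hΩb : Bornology.IsBounded Ω) {s : ℝ} (hs : 0 < s) (hs1 : s ≤ 1)
    (hG : ∀ a ∈ frontier Ω, GeomAt ε Ω s a) :
    ∃ C > 0, ∀ x ∈ Ω, ∃ c R, ApproxBall ε Ω C x c R := by
  set V : ℝ := (volume Ω).toReal + (volume (ball (0 : En n) 1)).toReal with hV
  have hV0 : 0 ≤ V := by positivity
  have hΩfin : volume Ω ≠ ⊤ := hΩb.measure_lt_top.ne
  set C : ℝ := V * (2 / s) ^ (n + ε) + 2 ^ n * s⁻¹ * 2 ^ (n + ε) + (diam Ω + 3) with hC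
  have hd0 : 0 ≤ diam Ω := diam_nonneg
  have hA1 : 0 ≤ V * (2 / s) ^ (n + ε) := by positivity
  have hA2 : 0 ≤ 2 ^ n * s⁻¹ * 2 ^ (n + ε) := by positivity
  have hC3 : diam Ω + 3 ≤ C := by rw [hC]; linarith
  have hCV : V * (2 / s) ^ (n + ε) ≤ C := by rw [hC]; linarith
  have hCs : 2 ^ n * s⁻¹ * 2 ^ (n + ε) ≤ C := by rw [hC]; linarith
  have hCpos : 0 < C := by linarith
  have hΩball : ∀ x ∈ Ω, Ω ⊆ ball x C := by
    intro x hx y hy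
    have := dist_le_diam_of_mem hΩb hy hx
    rw [mem_ball]; linarith
  -- volume bound for large radii
  have hbig : ∀ (S : Set (En n)) (c : En n) (r : ℝ), S ⊆ Ω ∪ ball c 1 → s < 2 * r →
      volume S ≤ ENNReal.ofReal (C * r ^ (n + ε)) := by
    intro S c r hS hr
    have hr0 : 0 < r := by linarith
    calc volume S ≤ volume Ω + volume (ball c 1) := (measure_mono hS).trans (measure_union_le _ _)
      _ = ENNReal.ofReal V := by
        rw [hV, ENNReal.ofReal_add (by positivity) (by positivity), ENNReal.ofReal_toReal hΩfin,
          ENNReal.ofReal_toReal measure_ball_lt_top.ne, Measure.addHaar_ball_center]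
      _ ≤ _ := by
        apply ENNReal.ofReal_le_ofReal
        have h1 : (1:ℝ) ≤ (2 * r / s) ^ (n + ε) :=
          Real.one_le_rpow (by rw [le_div_iff₀ hs]; linarith) (by positivity)
        have h2 : (2 * r / s) ^ (n + ε) = (2 / s) ^ (n + ε) * r ^ (n + ε) := by
          rw [← Real.mul_rpow (by positivity) hr0.le]; congr 1; ring
        calc V ≤ V * (2 * r / s) ^ (n + ε) := le_mul_of_one_le_right hV0 h1
          _ = V * (2 / s) ^ (n + ε) * r ^ (n + ε) := by rw [h2]; ring
          _ ≤ _ := by gcongr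
  refine ⟨C, hCpos, fun x hx => ?_⟩
  obtain ⟨a, haf, haΩ, hρ, hsub⟩ := nearest_pt hn hΩo hΩb x hx
  set ρ := ‖x - a‖ with hρd
  have hmax : ∀ r, ball x r ⊆ Ω → r ≤ ρ := by
    intro r hr
    by_contra hcon
    push Not at hcon
    refine haΩ (hr ?_)
    rw [mem_ball_iff_norm, norm_sub_rev]; exact hcon
  rcases le_or_gt ρ s with hρs | hρs
  · obtain ⟨⟨ν, hν, hgeo⟩, -⟩ := hG a haf
    have hxa := normal_unique hε0 hs a x ν hν hρ hsub fun y hy => (hgeo y hy).2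
    rw [← hρd] at hxa
    have hxc : ‖x - (a - s • ν)‖ = s - ρ := by
      have : x - (a - s • ν) = (s - ρ) • ν := by
        nth_rewrite 1 [hxa]
        rw [sub_smul]; abel
      rw [this, norm_smul, hν, mul_one, Real.norm_of_nonneg (by linarith)]
    have hin : ball x ρ ⊆ ball (a - s • ν) s := by
      apply ball_subset_ball'
      rw [dist_eq_norm, hxc]; linarith
    have hcap : ∀ y ∈ (Ω \ ball (a - s • ν) s ∪ ball (a - s • ν) s \ Ω), y ∈ ball a s →
        |inner ℝ ν (y - a)| ≤ s⁻¹ * ‖y - a‖ ^ (1 + ε) := by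
      intro y hy hya
      have e1 : ‖y - (a - s • ν)‖ ^ 2 = ‖y - a‖ ^ 2 + 2 * s * inner ℝ ν (y - a) + s ^ 2 := by
        have : y - (a - s • ν) = (y - a) + s • ν := by abel
        rw [this, norm_add_sq_real, norm_smul, hν, Real.norm_of_nonneg hs.le, inner_smul_right, real_inner_comm]
        ring
      have hya' : ‖y - a‖ < s := mem_ball_iff_norm.1 hya
      have hpw : ‖y - a‖ ^ 2 ≤ ‖y - a‖ ^ (1 + ε) := by
        rcases (norm_nonneg (y - a)).eq_or_lt with h0 | h0
        · rw [← h0, Real.zero_rpow (by linarith)]; simp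
        rw [← Real.rpow_two]
        exact Real.rpow_le_rpow_of_exponent_ge h0 (by linarith) (by linarith)
      set I := inner ℝ ν (y - a)
      set P := ‖y - a‖ ^ (1 + ε)
      have hP0 : 0 ≤ P := by positivity
      have hsP0 : 0 ≤ s⁻¹ * P := by positivity
      have hss : s * (s⁻¹ * P) = P := by field_simp
      obtain ⟨g1, g2⟩ := hgeo y hya
      rw [abs_le]
      rcases hy with ⟨hyΩ, hyB⟩ | ⟨hyB, hyΩ⟩
      · rw [mem_ball_iff_norm, not_lt] at hyB
        have hsq : s ^ 2 ≤ ‖y - (a - s • ν)‖ ^ 2 := by gcongr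
        constructor
        · by_contra hcon
          push Not at hcon
          have : s * I < s * (-(s⁻¹ * P)) := by gcongr
          nlinarith
        · by_contra hcon
          push Not at hcon
          exact g2 hcon hyΩ
      · rw [mem_ball_iff_norm] at hyB
        have hsq : ‖y - (a - s • ν)‖ ^ 2 < s ^ 2 := by gcongr
        constructor
        · by_contra hcon
          push Not at hcon
          exact hyΩ (g1 hcon)
        · by_contra hcon
          push Not at hcon
          have : 0 < s * I := by
            apply mul_pos hs; linarith
          nlinarith [sq_nonneg ‖y - a‖]
    have hB1 : ball (a - s • ν) s ⊆ ball (a - s • ν) 1 := ball_subset_ball hs1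
    refine ⟨a - s • ν, s, fun r hr => (ball_subset_ball (hmax r hr)).trans hin, ?_, ?_⟩
    · intro r hr
      rcases le_or_gt r ρ with hrρ | hrρ
      · have : (Ω \ ball (a - s • ν) s ∪ ball (a - s • ν) s \ Ω) ∩ ball x r = ∅ := by
          rw [← disjoint_iff_inter_eq_empty, Set.disjoint_left]
          intro y hy hyx
          have hyx' := ball_subset_ball hrρ hyx
          rcases hy with ⟨_, h⟩ | ⟨_, h⟩
          · exact h (hin hyx')
          · exact h (hsub hyx')
        rw [this]; simp
      rcases le_or_gt (2 * r) s with h2 | h2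
      · have hsl : (Ω \ ball (a - s • ν) s ∪ ball (a - s • ν) s \ Ω) ∩ ball x r ⊆
            {y ∈ ball a (2 * r) | |inner ℝ ν (y - a)| ≤ s⁻¹ * (2 * r) ^ (1 + ε)} := by
          rintro y ⟨hy, hyx⟩
          have hya : y ∈ ball a (2 * r) := by
            rw [mem_ball_iff_norm] at hyx ⊢
            calc ‖y - a‖ = ‖(y - x) + (x - a)‖ := by congr 1; abel
              _ ≤ ‖y - x‖ + ‖x - a‖ := norm_add_le _ _
              _ < 2 * r := by linarith
          refine ⟨hya, (hcap y hy (ball_subset_ball h2 hya)).trans ?_⟩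
          rw [mem_ball_iff_norm] at hya
          gcongr
        refine (measure_mono hsl).trans ((slab_volume hn a ν hν _ _ (by linarith) (by positivity)).trans ?_)
        apply ENNReal.ofReal_le_ofReal
        have e2 : (2 * r) ^ (1 + ε) * (2 * r) ^ (n - 1) = 2 ^ (n + ε) * r ^ (n + ε) := by
          rw [← Real.mul_rpow (by norm_num) hr.le, ← Real.rpow_natCast, ← Real.rpow_add (by linarith)]
          congr 1
          rw [Nat.cast_sub (by omega)]; push_cast; ring
        calc 2 ^ n * (s⁻¹ * (2 * r) ^ (1 + ε)) * (2 * r) ^ (n - 1)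
            = 2 ^ n * s⁻¹ * ((2 * r) ^ (1 + ε) * (2 * r) ^ (n - 1)) := by ring
          _ = 2 ^ n * s⁻¹ * 2 ^ (n + ε) * r ^ (n + ε) := by rw [e2]; ring
          _ ≤ _ := by gcongr
      · refine hbig _ (a - s • ν) r ?_ h2
        rintro y ⟨hy | hy, _⟩
        · exact Or.inl hy.1
        · exact Or.inr (hB1 hy.1)
    · rintro y (hy | hy)
      · exact hΩball x hx hy.1
      · have h1 := hy.1
        rw [mem_ball_iff_norm] at h1 ⊢
        have := norm_sub_le_norm_sub_add_norm_sub y (a - s • ν) x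
        rw [norm_sub_rev (a - s • ν) x, hxc] at this
        linarith
  · refine ⟨x, ρ, fun r hr => ball_subset_ball (hmax r hr), ?_, ?_⟩
    · intro r hr
      have hempty : ball x ρ \ Ω = ∅ := sdiff_eq_empty.2 hsub
      rw [hempty, union_empty]
      rcases le_or_gt r ρ with hrρ | hrρ
      · have : (Ω \ ball x ρ) ∩ ball x r = ∅ := by
          rw [← disjoint_iff_inter_eq_empty, Set.disjoint_left]
          intro y hy hyx
          exact hy.2 (ball_subset_ball hrρ hyx)
        rw [this]; simp
      · refine hbig _ x r ?_ (by linarith)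
        rintro y ⟨hy, _⟩
        exact Or.inl hy.1
    · rintro y (hy | hy)
      · exact hΩball x hx hy.1
      · exact hΩball x hx (hsub hy.1)

theorem cone_cond {n : ℕ} (hn : 0 < n) {ε : ℝ} {Ω : Set (En n)} (hΩo : IsOpen Ω)
    (hΩb : Bornology.IsBounded Ω) {s : ℝ}
    (hG : ∀ a ∈ frontier Ω, GeomAt ε Ω s a) :
    ∀ x ∈ Ω, ∀ z ∈ Ω, ‖x - z‖ < s / 6 → (∃ a ∉ Ω, ‖x - a‖ < 4 * ‖x - z‖) →
      ∃ e : En n, ‖e‖ = 1 ∧ ∀ t, 0 < t → t < s / 6 → ball (x - t • e) (s * t) ⊆ Ω ∧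
        ball (z - t • e) (s * t) ⊆ Ω := by
  rintro x hx z hz hxz ⟨b, hb, hxb⟩
  obtain ⟨a, haf, haΩ, hρ, hsub⟩ := nearest_pt hn hΩo hΩb x hx
  have hab : ‖x - a‖ ≤ ‖x - b‖ := by
    by_contra hcon
    push Not at hcon
    refine hb (hsub ?_)
    rw [mem_ball_iff_norm, norm_sub_rev]; exact hcon
  obtain ⟨-, e, he, h⟩ := hG a haf
  have hxs : x ∈ ball a s := by rw [mem_ball_iff_norm]; linarith
  have hzs : z ∈ ball a s := by
    rw [mem_ball_iff_norm]
    have : ‖z - a‖ ≤ ‖x - z‖ + ‖x - a‖ := by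
      rw [norm_sub_rev x z]
      exact norm_sub_le_norm_sub_add_norm_sub z x a
    linarith
  exact ⟨e, he, fun t ht hts => ⟨h x hx hxs t ht (by linarith), h z hz hzs t ht (by linarith)⟩⟩

def nk (C α β : ℝ) : ℝ := C * 2 ^ β * (1 - 2 ^ (β - α))⁻¹
def fk (C α β : ℝ) : ℝ := C * 2 ^ α * (1 - 2 ^ (α - β))⁻¹

theorem one_sub_two_rpow_pos {t : ℝ} (ht : t < 0) : 0 < 1 - (2:ℝ) ^ t := by
  have := Real.rpow_lt_one_of_one_lt_of_neg (x := 2) (by norm_num) ht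
  linarith

theorem nk_nonneg {C α β : ℝ} (hC : 0 ≤ C) (h : β < α) : 0 ≤ nk C α β := by
  have := one_sub_two_rpow_pos (t := β - α) (by linarith)
  unfold nk; positivity

theorem fk_nonneg {C α β : ℝ} (hC : 0 ≤ C) (h : α < β) : 0 ≤ fk C α β := by
  have := one_sub_two_rpow_pos (t := α - β) (by linarith)
  unfold fk; positivity

theorem int_bound {n : ℕ} (hn : 0 < n) {S : Set (En n)} (hS : MeasurableSet S) (x : En n) (F : En n → ℂ)
    (hF : AEStronglyMeasurable F (volume.restrict S)) (B β I : ℝ) (hB : 0 ≤ B) (hI : 0 ≤ I)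
    (hb : ∀ y ∈ S, y ≠ x → ‖F y‖ ≤ B * ‖y - x‖ ^ (-β))
    (hIntB : ∫⁻ y in S, ENNReal.ofReal (‖y - x‖ ^ (-β)) ≤ ENNReal.ofReal I) :
    IntegrableOn F S ∧ ‖∫ y in S, F y‖ ≤ B * I := by
  have : Nontrivial (En n) := by
    have : Nonempty (Fin n) := ⟨⟨0, hn⟩⟩
    infer_instance
  have hne : ∀ᵐ y : En n, y ≠ x := by
    rw [ae_iff]; simp
  have h1 : ∫⁻ y in S, ‖F y‖ₑ ≤ ENNReal.ofReal (B * I) := by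
    calc ∫⁻ y in S, ‖F y‖ₑ ≤ ∫⁻ y in S, ENNReal.ofReal B * ENNReal.ofReal (‖y - x‖ ^ (-β)) := by
          apply lintegral_mono_ae
          filter_upwards [ae_restrict_mem hS, ae_restrict_of_ae hne] with y hy hyx
          rw [← ENNReal.ofReal_mul hB, ← ofReal_norm]
          exact ENNReal.ofReal_le_ofReal (hb y hy hyx)
      _ = ENNReal.ofReal B * ∫⁻ y in S, ENNReal.ofReal (‖y - x‖ ^ (-β)) :=
          lintegral_const_mul' _ _ ENNReal.ofReal_ne_top
      _ ≤ _ := by rw [ENNReal.ofReal_mul hB]; gcongr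
  refine ⟨⟨hF, lt_of_le_of_lt h1 ENNReal.ofReal_lt_top⟩, ?_⟩
  have h2 := (enorm_integral_le_lintegral_enorm (μ := volume.restrict S) F).trans h1
  rw [← ofReal_norm] at h2
  exact (ENNReal.ofReal_le_ofReal_iff (by positivity)).1 h2

theorem near_int {n : ℕ} (hn : 0 < n) {S : Set (En n)} (hS : MeasurableSet S) (x : En n) (F : En n → ℂ)
    (hF : AEStronglyMeasurable F (volume.restrict S)) (B C α β D : ℝ) (hB : 0 ≤ B)
    (hC : 0 ≤ C) (hβ : 0 < β) (hαβ : β < α) (hD : 0 < D)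
    (hvol : ∀ r > 0, volume (S ∩ ball x r) ≤ ENNReal.ofReal (C * r ^ α)) (hSD : S ⊆ ball x D)
    (hb : ∀ y ∈ S, y ≠ x → ‖F y‖ ≤ B * ‖y - x‖ ^ (-β)) :
    IntegrableOn F S ∧ ‖∫ y in S, F y‖ ≤ B * (nk C α β * D ^ (α - β)) := by
  refine int_bound hn hS x F hF B β _ hB ?_ hb ?_
  · have := nk_nonneg hC hαβ; positivity
  · have := near_bound S hS x C α β D hC hβ hαβ hD hvol
    rwa [inter_eq_left.2 hSD] at this

theorem far_int {n : ℕ} (hn : 0 < n) {S : Set (En n)} (hS : MeasurableSet S) (x : En n) (F : En n → ℂ)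
    (hF : AEStronglyMeasurable F (volume.restrict S)) (B C α β ρ : ℝ) (hB : 0 ≤ B)
    (hC : 0 ≤ C) (hα : 0 ≤ α) (hαβ : α < β) (hρ : 0 < ρ)
    (hvol : ∀ r > 0, volume (S ∩ ball x r) ≤ ENNReal.ofReal (C * r ^ α)) (hSD : Disjoint S (ball x ρ))
    (hb : ∀ y ∈ S, y ≠ x → ‖F y‖ ≤ B * ‖y - x‖ ^ (-β)) :
    IntegrableOn F S ∧ ‖∫ y in S, F y‖ ≤ B * (fk C α β * ρ ^ (α - β)) := by
  refine int_bound hn hS x F hF B β _ hB ?_ hb ?_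
  · have := fk_nonneg hC hαβ; positivity
  · have := far_bound S hS x C α β ρ hC hα hαβ hρ hvol
    rwa [hSD.sdiff_eq_left] at this

def vb (n : ℕ) : ℝ := (volume (ball (0 : En n) 1)).toReal

theorem vb_nonneg (n : ℕ) : 0 ≤ vb n := ENNReal.toReal_nonneg

theorem vol_le {n : ℕ} (S : Set (En n)) (x : En n) :
    ∀ r > 0, volume (S ∩ ball x r) ≤ ENNReal.ofReal (vb n * r ^ (n : ℝ)) := by
  intro r hr
  refine (measure_mono inter_subset_right).trans ?_
  rw [Measure.addHaar_ball_of_pos volume x hr, Real.rpow_natCast, vb, mul_comm, ENNReal.ofReal_mul ENNReal.toReal_nonneg,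
    ENNReal.ofReal_toReal measure_ball_lt_top.ne]
  simp

theorem ker_diff {n : ℕ} {K : En n → ℝ} {M : ℝ} (hd : ∀ v, v ≠ 0 → DifferentiableAt ℝ K v)
    (hg : ∀ v, v ≠ 0 → ‖fderiv ℝ K v‖ * ‖v‖ ^ (n + 1) ≤ M) (x z y : En n)
    (hxy : y ≠ x) (hxz : ‖x - z‖ ≤ ‖y - x‖ / 2) :
    |K (x - y) - K (z - y)| ≤ 2 ^ (n + 1) * M * ‖x - z‖ * ‖y - x‖ ^ (-((n : ℝ) + 1)) := by
  set L := ‖y - x‖ with hL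
  have hL0 : 0 < L := by rw [hL, norm_pos_iff, sub_ne_zero]; exact hxy
  have hlow : ∀ v ∈ closedBall (x - y) (L / 2), L / 2 ≤ ‖v‖ := by
    intro v hv
    rw [mem_closedBall_iff_norm] at hv
    have := norm_sub_norm_le (x - y) v
    rw [norm_sub_rev x y, norm_sub_rev (x - y) v] at this
    linarith
  have hv0 : ∀ v ∈ closedBall (x - y) (L / 2), v ≠ 0 := by
    intro v hv h0
    have := hlow v hv
    rw [h0, norm_zero] at this
    linarith
  have key := (convex_closedBall (x - y) (L / 2)).norm_image_sub_le_of_norm_fderiv_le (𝕜 := ℝ) (f := K)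
    (C := M / (L / 2) ^ (n + 1)) (x := z - y) (y := x - y) (fun v hv => hd v (hv0 v hv)) (fun v hv => ?_) ?_ ?_
  · rw [Real.norm_eq_abs, show x - y - (z - y) = x - z by abel] at key
    refine key.trans (le_of_eq ?_)
    have : ((n : ℝ) + 1) = ((n + 1 : ℕ) : ℝ) := by push_cast; ring
    rw [Real.rpow_neg hL0.le, this, Real.rpow_natCast, div_pow]
    field_simp
  · rw [le_div_iff₀ (by positivity)]
    refine le_trans ?_ (hg v (hv0 v hv))
    have := hlow v hv
    gcongr
  · rw [mem_closedBall_iff_norm, show z - y - (x - y) = z - x by abel, norm_sub_rev]; exact hxz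
  · exact mem_closedBall_self (by positivity)

theorem ball_lemma' {n : ℕ} (hn : 0 < n) {K : En n → ℝ} {M : ℝ} (h : IsKer n K M)
    (c z : En n) (R δ : ℝ) (hδ : 0 < δ) (hR : ‖z - c‖ + δ < R) :
    ∫ y in ball c R ∩ {y | δ < dist y z}, (K (z - y) : ℂ) = 0 := by
  rw [integral_complex_ofReal]
  rw [Complex.ofReal_eq_zero]
  have h1 := ball_lemma hn h (z - c) R δ hδ hR
  have hA : MeasurableSet (ball (z - c) R ∩ {y : En n | δ < ‖y‖}) :=
    measurableSet_ball.inter (isOpen_lt (by fun_prop) (by fun_prop)).measurableSet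
  have hB : MeasurableSet (ball c R ∩ {y : En n | δ < dist y z}) :=
    measurableSet_ball.inter (isOpen_lt (by fun_prop) (by fun_prop)).measurableSet
  rw [← integral_indicator hA] at h1
  rw [← integral_indicator hB, ← h1, ← integral_sub_left_eq_self _ volume z]
  congr 1
  funext y
  have e1 : z - y ∈ ball c R ∩ {y | δ < dist y z} ↔ y ∈ ball (z - c) R ∩ {y : En n | δ < ‖y‖} := by
    simp only [mem_inter_iff, mem_ball_iff_norm, mem_ofPred_eq, dist_eq_norm]
    rw [show z - y - c = -(y - (z - c)) by abel, norm_neg, show z - y - z = - y by abel, norm_neg]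
  by_cases hy : y ∈ ball (z - c) R ∩ {y : En n | δ < ‖y‖}
  · rw [indicator_of_mem hy, indicator_of_mem (e1.2 hy), sub_sub_cancel]
  · rw [indicator_of_notMem hy, indicator_of_notMem (fun h => hy (e1.1 h))]

structure LipF {n : ℕ} (ε : ℝ) (Ω : Set (En n)) (A : ℝ) (f : En n → ℂ) : Prop where
  bd : ∀ y ∈ Ω, ‖f y‖ ≤ A
  hol : ∀ y ∈ Ω, ∀ z ∈ Ω, ‖f y - f z‖ ≤ A * ‖y - z‖ ^ ε

theorem LipF.cont {n : ℕ} {ε : ℝ} (hε0 : 0 < ε) {Ω : Set (En n)} {A : ℝ} {f : En n → ℂ}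
    (h : LipF ε Ω A f) : ContinuousOn f Ω := by
  intro x hx
  rw [ContinuousWithinAt, tendsto_iff_norm_sub_tendsto_zero]
  have hlim : Tendsto (fun y : En n => A * ‖y - x‖ ^ ε) (𝓝[Ω] x) (𝓝 0) := by
    have h1 : Continuous (fun y : En n => A * ‖y - x‖ ^ ε) :=
      continuous_const.mul ((by fun_prop : Continuous fun y : En n => ‖y - x‖).rpow_const (fun _ => Or.inr hε0.le))
    have h2 := h1.tendsto x
    simp only [sub_self, norm_zero, Real.zero_rpow hε0.ne', mul_zero] at h2
    exact h2.mono_left nhdsWithin_le_nhds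
  refine squeeze_zero' (Eventually.of_forall fun _ => norm_nonneg _) ?_ hlim
  filter_upwards [self_mem_nhdsWithin] with y hy
  exact h.hol y hy x hx

theorem kerC_meas {n : ℕ} {K : En n → ℝ} {M : ℝ} (h : IsKer n K M) (z : En n) :
    Measurable (fun y => (K (z - y) : ℂ)) :=
  Complex.measurable_ofReal.comp (h.meas.comp (measurable_const.sub measurable_id))

theorem kerC_bound {n : ℕ} {K : En n → ℝ} {M : ℝ} (h : IsKer n K M) (z y : En n) (hy : y ≠ z) :
    ‖(K (z - y) : ℂ)‖ ≤ M * ‖y - z‖ ^ (-(n : ℝ)) := by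
  rw [Complex.norm_real, Real.norm_eq_abs, norm_sub_rev]
  exact h.le_of (sub_ne_zero.2 hy.symm)

theorem kerC_int {n : ℕ} (hn : 0 < n) {K : En n → ℝ} {M : ℝ} (h : IsKer n K M) (z : En n)
    (A : Set (En n)) (hA : MeasurableSet A) (hAf : volume A < ⊤) (δ : ℝ) (hδ : 0 < δ)
    (hAδ : Disjoint A (ball z δ)) : IntegrableOn (fun y => (K (z - y) : ℂ)) A := by
  have hM := h.nonneg hn
  apply IntegrableOn.of_bound hAf (kerC_meas h z).aestronglyMeasurable (M * δ ^ (-(n:ℝ)))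
  filter_upwards [ae_restrict_mem hA] with y hy
  have h1 : δ ≤ ‖y - z‖ := by
    by_contra hcon
    exact Set.disjoint_left.1 hAδ hy (mem_ball_iff_norm.2 (not_le.1 hcon))
  have h2 : y ≠ z := by
    rintro rfl
    rw [sub_self, norm_zero] at h1
    linarith
  refine (kerC_bound h z y h2).trans ?_
  apply mul_le_mul_of_nonneg_left _ hM
  exact Real.rpow_le_rpow_of_nonpos hδ h1 (by simp)

theorem exists_sep {n : ℕ} {c z : En n} {R : ℝ} (hz : z ∈ ball c R) :
    ∃ δ > 0, ∀ δ' ≤ δ, ‖z - c‖ + δ' < R ∧ ball z δ' ⊆ ball c R := by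
  rw [mem_ball_iff_norm] at hz
  refine ⟨(R - ‖z - c‖) / 2, by linarith, fun δ' hδ' => ⟨by linarith, ?_⟩⟩
  apply ball_subset_ball'
  rw [dist_eq_norm]; linarith

theorem ball_diff_zero {n : ℕ} (hn : 0 < n) {K : En n → ℝ} {M : ℝ} (h : IsKer n K M)
    (c c' z : En n) (R R' : ℝ) (hz : z ∈ ball c' R') (hsub : ball c' R' ⊆ ball c R) :
    ∫ y in ball c R \ ball c' R', (K (z - y) : ℂ) = 0 := by
  obtain ⟨δ1, hδ1, h1⟩ := exists_sep hz
  obtain ⟨δ2, hδ2, h2⟩ := exists_sep (hsub hz)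
  have hmin : 0 < min δ1 δ2 := lt_min hδ1 hδ2
  have hm1 : min δ1 δ2 ≤ δ1 := min_le_left _ _
  have hm2 : min δ1 δ2 ≤ δ2 := min_le_right _ _
  set δ := min δ1 δ2 / 2 with hδd
  have hδ : 0 < δ := by linarith
  obtain ⟨a1, a2⟩ := h1 δ (by linarith)
  obtain ⟨b1, b2⟩ := h2 δ (by linarith)
  have e1 := ball_lemma' hn h c z R δ hδ b1
  have e2 := ball_lemma' hn h c' z R' δ hδ a1
  obtain ⟨a1', a2'⟩ := h1 δ1 le_rfl
  have hopen : MeasurableSet {y : En n | δ < dist y z} :=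
    (isOpen_lt (by fun_prop) (by fun_prop)).measurableSet
  have hset : ball c R ∩ {y | δ < dist y z} = (ball c' R' ∩ {y | δ < dist y z}) ∪ (ball c R \ ball c' R') := by
    ext y
    constructor
    · rintro ⟨hy1, hy2⟩
      by_cases hy : y ∈ ball c' R'
      · exact Or.inl ⟨hy, hy2⟩
      · exact Or.inr ⟨hy1, hy⟩
    · rintro (⟨hy1, hy2⟩ | ⟨hy1, hy2⟩)
      · exact ⟨hsub hy1, hy2⟩
      · refine ⟨hy1, ?_⟩
        by_contra hcon
        refine hy2 (a2' ?_)
        rw [mem_ofPred_eq, not_lt] at hcon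
        rw [mem_ball]
        linarith
  rw [hset, setIntegral_union ?_ (measurableSet_ball.diff measurableSet_ball), e2, zero_add] at e1
  · exact e1
  · refine kerC_int hn h z _ (measurableSet_ball.inter hopen) (lt_of_le_of_lt (measure_mono inter_subset_left) measure_ball_lt_top) δ hδ ?_
    rw [Set.disjoint_left]
    rintro y ⟨_, hy⟩ hy2
    rw [mem_ball] at hy2
    rw [mem_ofPred_eq] at hy
    linarith
  · refine kerC_int hn h z _ (measurableSet_ball.diff measurableSet_ball) (lt_of_le_of_lt (measure_mono sdiff_subset) measure_ball_lt_top) δ hδ ?_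
    rw [Set.disjoint_left]
    rintro y hy hy2
    exact hy.2 (a2 hy2)
  · rw [Set.disjoint_left]
    rintro y hy hy2
    exact hy2.2 hy.1

theorem diff_lemma {n : ℕ} (hn : 0 < n) {K : En n → ℝ} {M : ℝ} (h : IsKer n K M) {Ω : Set (En n)} (hΩ : MeasurableSet Ω)
    (hΩf : volume Ω < ⊤)
    (c c' z : En n) (R R' : ℝ) (hz : z ∈ ball c' R') (hsub : ball c' R' ⊆ ball c R) (hsub' : ball c' R' ⊆ Ω) :
    ∫ y in Ω \ ball c' R', (K (z - y) : ℂ) =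
      (∫ y in Ω \ ball c R, (K (z - y) : ℂ)) - ∫ y in ball c R \ Ω, (K (z - y) : ℂ) := by
  obtain ⟨δ, hδ, h1⟩ := exists_sep hz
  obtain ⟨a1, a2⟩ := h1 δ le_rfl
  have e1 := ball_diff_zero hn h c c' z R R' hz hsub
  have hI : ∀ S, MeasurableSet S → volume S < ⊤ → Disjoint S (ball c' R') →
      IntegrableOn (fun y => (K (z - y) : ℂ)) S := fun S hS hSf hd =>
    kerC_int hn h z S hS hSf δ hδ (hd.mono_right a2)
  have hB : volume (ball c R) < ⊤ := measure_ball_lt_top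
  have mB : MeasurableSet (ball c R) := measurableSet_ball
  have mB' : MeasurableSet (ball c' R') := measurableSet_ball
  have s1 : ball c R \ ball c' R' = (ball c R \ Ω) ∪ ((Ω ∩ ball c R) \ ball c' R') := by
    ext y
    have := @hsub' y
    simp only [Set.mem_sdiff, mem_union, mem_inter_iff]
    tauto
  have s2 : Ω \ ball c' R' = (Ω \ ball c R) ∪ ((Ω ∩ ball c R) \ ball c' R') := by
    ext y
    have := @hsub y
    simp only [Set.mem_sdiff, mem_union, mem_inter_iff]
    tauto
  have i3 : IntegrableOn (fun y => (K (z - y) : ℂ)) ((Ω ∩ ball c R) \ ball c' R') :=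
    hI _ ((hΩ.inter mB).diff mB') (lt_of_le_of_lt (measure_mono (sdiff_subset.trans inter_subset_left)) hΩf)
      disjoint_sdiff_left
  rw [s1, setIntegral_union ?_ ((hΩ.inter mB).diff mB') ?_ i3] at e1
  · rw [s2, setIntegral_union ?_ ((hΩ.inter mB).diff mB') ?_ i3]
    · linear_combination e1
    · rw [Set.disjoint_left]; rintro y hy hy2; exact hy.2 hy2.1.2
    · exact hI _ (hΩ.diff mB) (lt_of_le_of_lt (measure_mono sdiff_subset) hΩf)
        (disjoint_sdiff_left.mono_right hsub)
  · rw [Set.disjoint_left]; rintro y hy hy2; exact hy.2 hy2.1.1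
  · exact hI _ (mB.diff hΩ) (lt_of_le_of_lt (measure_mono sdiff_subset) hB)
        (disjoint_sdiff_left.mono_right hsub')

theorem near_part {n : ℕ} (hn : 0 < n) {ε : ℝ} (hε0 : 0 < ε) (hε1 : ε < 1) {K : En n → ℝ} {M : ℝ} (h : IsKer n K M) {Ω : Set (En n)}
    {f : En n → ℂ} {A : ℝ} (hf : LipF ε Ω A f) (hA : 0 ≤ A)
    (z : En n) (hz : z ∈ Ω) (S : Set (En n)) (hS : MeasurableSet S) (hSΩ : S ⊆ Ω) (D : ℝ) (hD : 0 < D) (hSD : S ⊆ ball z D) :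
    IntegrableOn (fun y => (f y - f z) * (K (z - y) : ℂ)) S ∧
    ‖∫ y in S, (f y - f z) * (K (z - y) : ℂ)‖ ≤ A * M * (nk (vb n) n (n - ε) * D ^ ε) := by
  have hM := h.nonneg hn
  have hn1 : (1:ℝ) ≤ n := by exact_mod_cast hn
  have := near_int hn hS z (fun y => (f y - f z) * (K (z - y) : ℂ)) ?_ (A * M) (vb n) n (n - ε) D (by positivity)
    (vb_nonneg n) (by linarith) (by linarith) hD (vol_le S z) hSD ?_
  · simpa using this
  · exact ((((hf.cont hε0).mono hSΩ).aestronglyMeasurable hS).sub aestronglyMeasurable_const).mul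
      (kerC_meas h z).aestronglyMeasurable
  · intro y hy hyz
    have hp : 0 < ‖y - z‖ := norm_pos_iff.2 (sub_ne_zero.2 hyz)
    rw [norm_mul]
    calc ‖f y - f z‖ * ‖(K (z - y) : ℂ)‖ ≤ (A * ‖y - z‖ ^ ε) * (M * ‖y - z‖ ^ (-(n:ℝ))) := by
          gcongr
          · exact hf.hol y (hSΩ hy) z hz
          · exact kerC_bound h z y hyz
      _ = A * M * (‖y - z‖ ^ ε * ‖y - z‖ ^ (-(n:ℝ))) := by ring
      _ = _ := by rw [← Real.rpow_add hp]; congr 2; ring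

theorem fK_int {n : ℕ} (hn : 0 < n) {ε : ℝ} (hε0 : 0 < ε) {K : En n → ℝ} {M : ℝ} (h : IsKer n K M) {Ω : Set (En n)}
    {f : En n → ℂ} {A : ℝ} (hf : LipF ε Ω A f)
    (z : En n) (S : Set (En n)) (hS : MeasurableSet S) (hSΩ : S ⊆ Ω) (hSf : volume S < ⊤)
    (δ : ℝ) (hδ : 0 < δ) (hd : Disjoint S (ball z δ)) :
    IntegrableOn (fun y => f y * (K (z - y) : ℂ)) S := by
  refine (kerC_int hn h z S hS hSf δ hδ hd).bdd_mul (c := A) (((hf.cont hε0).mono hSΩ).aestronglyMeasurable hS) ?_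
  filter_upwards [ae_restrict_mem hS] with y hy
  exact hf.bd y (hSΩ hy)

theorem rep_lemma {n : ℕ} (hn : 0 < n) {ε : ℝ} (hε0 : 0 < ε) (hε1 : ε < 1) {K : En n → ℝ} {M : ℝ} (h : IsKer n K M)
    {Ω : Set (En n)} (hΩo : IsOpen Ω) (hΩf : volume Ω < ⊤)
    {f : En n → ℂ} {A : ℝ} (hf : LipF ε Ω A f) (hA : 0 ≤ A)
    (c z : En n) (R : ℝ) (hz : z ∈ ball c R) (hsub : ball c R ⊆ Ω) :
    Tendsto (fun δ : ℝ => ∫ y in {y ∈ Ω | δ < dist y z}, f y * (K (z - y) : ℂ)) (𝓝[>] 0)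
      (𝓝 ((∫ y in ball c R, (f y - f z) * (K (z - y) : ℂ)) + ∫ y in Ω \ ball c R, f y * (K (z - y) : ℂ))) := by
  obtain ⟨δ0, hδ0, hsep⟩ := exists_sep hz
  have : Nontrivial (En n) := by
    have : Nonempty (Fin n) := ⟨⟨0, hn⟩⟩
    infer_instance
  have hne : ∀ᵐ y : En n, y ≠ z := by
    rw [ae_iff]; simp
  have hR0 : 0 < R := pos_of_mem_ball hz
  have mB : MeasurableSet (ball c R) := measurableSet_ball
  have hF := (near_part hn hε0 hε1 h hf hA z (hsub hz) (ball c R) mB hsub (2 * R) (by linarith) (by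
    apply ball_subset_ball'
    rw [mem_ball, dist_comm] at hz
    linarith)).1
  have hmeas : ∀ δ : ℝ, MeasurableSet {y : En n | δ < dist y z} := fun δ =>
    (isOpen_lt (by fun_prop) (by fun_prop)).measurableSet
  have hlim : Tendsto (fun δ : ℝ => ∫ y in ball c R, {y : En n | δ < dist y z}.indicator
      (fun y => (f y - f z) * (K (z - y) : ℂ)) y) (𝓝[>] 0)
      (𝓝 (∫ y in ball c R, (f y - f z) * (K (z - y) : ℂ))) := by
    refine tendsto_integral_filter_of_dominated_convergence
      (fun y => ‖(f y - f z) * (K (z - y) : ℂ)‖) ?_ ?_ hF.norm ?_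
    · exact Eventually.of_forall fun δ => hF.1.indicator (hmeas δ)
    · exact Eventually.of_forall fun δ => Eventually.of_forall fun y => norm_indicator_le_norm_self _ _
    · filter_upwards [ae_restrict_of_ae hne] with y hy
      apply tendsto_const_nhds.congr'
      have : Iio (dist y z) ∈ 𝓝[>] (0:ℝ) := mem_nhdsWithin_of_mem_nhds (Iio_mem_nhds (dist_pos.2 hy))
      filter_upwards [this] with δ hδ
      rw [indicator_of_mem (show y ∈ {y : En n | δ < dist y z} from hδ)]
  refine (hlim.add_const _).congr' ?_
  have : Iio δ0 ∈ 𝓝[>] (0:ℝ) := mem_nhdsWithin_of_mem_nhds (Iio_mem_nhds hδ0)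
  filter_upwards [this, self_mem_nhdsWithin] with δ hδ1 hδ
  obtain ⟨b1, b2⟩ := hsep δ (le_of_lt hδ1)
  have hset : {y ∈ Ω | δ < dist y z} = (ball c R ∩ {y | δ < dist y z}) ∪ (Ω \ ball c R) := by
    ext y
    constructor
    · rintro ⟨hy1, hy2⟩
      by_cases hy : y ∈ ball c R
      · exact Or.inl ⟨hy, hy2⟩
      · exact Or.inr ⟨hy1, hy⟩
    · rintro (⟨hy1, hy2⟩ | ⟨hy1, hy2⟩)
      · exact ⟨hsub hy1, hy2⟩
      · refine ⟨hy1, ?_⟩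
        by_contra hcon
        rw [not_lt] at hcon
        refine hy2 ((hsep δ0 le_rfl).2 ?_)
        rw [mem_ball]
        exact lt_of_le_of_lt hcon hδ1
  have hd1 : Disjoint (ball c R ∩ {y | δ < dist y z}) (ball z δ) := by
    rw [Set.disjoint_left]
    rintro y ⟨_, hy⟩ hy2
    rw [mem_ball] at hy2
    rw [mem_ofPred_eq] at hy
    linarith
  have m1 : MeasurableSet (ball c R ∩ {y | δ < dist y z}) := mB.inter (hmeas δ)
  have f1 : volume (ball c R ∩ {y | δ < dist y z}) < ⊤ :=
    lt_of_le_of_lt (measure_mono inter_subset_left) measure_ball_lt_top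
  rw [hset, setIntegral_union ?_ (hΩo.measurableSet.diff mB)
    (fK_int hn hε0 h hf z _ m1 (inter_subset_left.trans hsub) f1 δ hδ hd1)
    (fK_int hn hε0 h hf z _ (hΩo.measurableSet.diff mB) sdiff_subset
      (lt_of_le_of_lt (measure_mono sdiff_subset) hΩf) δ hδ (disjoint_sdiff_left.mono_right b2))]
  · congr 1
    rw [setIntegral_indicator (hmeas δ)]
    have e0 := ball_lemma' hn h c z R δ hδ b1
    have ik := kerC_int hn h z _ m1 f1 δ hδ hd1
    have : ∫ y in ball c R ∩ {y | δ < dist y z}, f y * (K (z - y) : ℂ) =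
       (∫ y in ball c R ∩ {y | δ < dist y z}, (f y - f z) * (K (z - y) : ℂ)) +
        ∫ y in ball c R ∩ {y | δ < dist y z}, f z * (K (z - y) : ℂ) := by
      rw [← integral_add (hF.mono_set inter_subset_left) (ik.const_mul _)]
      congr 1
      funext y
      ring
    rw [this, integral_const_mul, e0, mul_zero, add_zero]
  · rw [Set.disjoint_left]
    rintro y hy hy2
    exact hy2.2 hy.1

theorem bound_est {n : ℕ} (hn : 0 < n) {ε : ℝ} (hε0 : 0 < ε) (hε1 : ε < 1) {K : En n → ℝ} {M : ℝ} (h : IsKer n K M)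
    {Ω : Set (En n)} (hΩo : IsOpen Ω) (hΩb : Bornology.IsBounded Ω)
    {f : En n → ℂ} {A : ℝ} (hf : LipF ε Ω A f) (hA : 0 ≤ A) {C1 : ℝ} (hC1 : 0 < C1)
    (x c : En n) (R ρ : ℝ) (hρ : 0 < ρ) (hsub : ball x ρ ⊆ Ω) (hAB : ApproxBall ε Ω C1 x c R) :
    ‖(∫ y in ball x ρ, (f y - f x) * (K (x - y) : ℂ)) + ∫ y in Ω \ ball x ρ, f y * (K (x - y) : ℂ)‖ ≤
      (nk (vb n) n (n - ε) * (diam Ω + 1) ^ ε + 2 * (nk C1 (n + ε) n * C1 ^ ε)) * M * A := by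
  obtain ⟨hin, hvol, hbd⟩ := hAB
  have hM := h.nonneg hn
  have hn1 : (1:ℝ) ≤ n := by exact_mod_cast hn
  have hΩf : volume Ω < ⊤ := hΩb.measure_lt_top
  have mΩ := hΩo.measurableSet
  have mB : MeasurableSet (ball x ρ) := measurableSet_ball
  have mB2 : MeasurableSet (ball c R) := measurableSet_ball
  have hxΩ : x ∈ Ω := hsub (mem_ball_self hρ)
  have hD : Ω ⊆ ball x (diam Ω + 1) := by
    intro y hy
    have := dist_le_diam_of_mem hΩb hy hxΩ
    rw [mem_ball]; linarith
  have hd0 : 0 ≤ diam Ω := diam_nonneg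
  obtain ⟨i1, b1⟩ := near_part hn hε0 hε1 h hf hA x hxΩ Ω mΩ Subset.rfl (diam Ω + 1) (by linarith) hD
  have ik := kerC_int hn h x (Ω \ ball x ρ) (mΩ.diff mB) (lt_of_le_of_lt (measure_mono sdiff_subset) hΩf) ρ hρ
    disjoint_sdiff_left
  have e1 : (∫ y in ball x ρ, (f y - f x) * (K (x - y) : ℂ)) + ∫ y in Ω \ ball x ρ, f y * (K (x - y) : ℂ)
      = (∫ y in Ω, (f y - f x) * (K (x - y) : ℂ)) + f x * ∫ y in Ω \ ball x ρ, (K (x - y) : ℂ) := by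
    have s1 : Ω = ball x ρ ∪ (Ω \ ball x ρ) := (union_sdiff_cancel hsub).symm
    have e2 : ∫ y in Ω, (f y - f x) * (K (x - y) : ℂ) = (∫ y in ball x ρ, (f y - f x) * (K (x - y) : ℂ)) +
        ∫ y in Ω \ ball x ρ, (f y - f x) * (K (x - y) : ℂ) := by
      conv_lhs => rw [s1]
      exact setIntegral_union disjoint_sdiff_right (mΩ.diff mB) (i1.mono_set hsub) (i1.mono_set sdiff_subset)
    have e3 : ∫ y in Ω \ ball x ρ, f y * (K (x - y) : ℂ) =
        (∫ y in Ω \ ball x ρ, (f y - f x) * (K (x - y) : ℂ)) + ∫ y in Ω \ ball x ρ, f x * (K (x - y) : ℂ) := by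
      rw [← integral_add (i1.mono_set sdiff_subset) (ik.const_mul _)]
      congr 1
      funext y
      ring
    rw [e2, e3, integral_const_mul]
    ring
  have hpart : ∀ S, MeasurableSet S → S ⊆ (Ω \ ball c R ∪ ball c R \ Ω) →
      ‖∫ y in S, (K (x - y) : ℂ)‖ ≤ M * (nk C1 (n + ε) n * C1 ^ ε) := by
    intro S hS hSs
    have := (near_int hn hS x (fun y => (K (x - y) : ℂ)) (kerC_meas h x).aestronglyMeasurable M C1 (n + ε) n C1 hM
      hC1.le (by linarith) (by linarith) hC1
      (fun r hr => (measure_mono (inter_subset_inter_left _ hSs)).trans (hvol r hr)) (hSs.trans hbd)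
      (fun y _ hy => kerC_bound h x y hy)).2
    simpa using this
  have hdl := diff_lemma hn h mΩ hΩf c x x R ρ (mem_ball_self hρ) (hin ρ hsub) hsub
  have b2 : ‖∫ y in Ω \ ball x ρ, (K (x - y) : ℂ)‖ ≤ 2 * (M * (nk C1 (n + ε) n * C1 ^ ε)) := by
    rw [hdl]
    refine (norm_sub_le _ _).trans ?_
    have p1 := hpart _ (mΩ.diff mB2) subset_union_left
    have p2 := hpart _ (mB2.diff mΩ) subset_union_right
    linarith
  rw [e1]
  refine (norm_add_le _ _).trans ?_
  rw [norm_mul]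
  have b3 : ‖f x‖ * ‖∫ y in Ω \ ball x ρ, (K (x - y) : ℂ)‖ ≤ A * (2 * (M * (nk C1 (n + ε) n * C1 ^ ε))) := by
    gcongr
    exact hf.bd x hxΩ
  calc _ ≤ A * M * (nk (vb n) n (n - ε) * (diam Ω + 1) ^ ε) + A * (2 * (M * (nk C1 (n + ε) n * C1 ^ ε))) :=
        add_le_add b1 b3
    _ = _ := by ring

theorem holder_est {n : ℕ} (hn : 0 < n) {ε : ℝ} (hε0 : 0 < ε) (hε1 : ε < 1) {K : En n → ℝ} {M : ℝ} (h : IsKer n K M)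
    (hd : ∀ v, v ≠ 0 → DifferentiableAt ℝ K v)
    (hg : ∀ v, v ≠ 0 → ‖fderiv ℝ K v‖ * ‖v‖ ^ (n + 1) ≤ M)
    {Ω : Set (En n)} (hΩo : IsOpen Ω) (hΩb : Bornology.IsBounded Ω)
    {f : En n → ℂ} {A : ℝ} (hf : LipF ε Ω A f) (hA : 0 ≤ A) {C1 : ℝ} (hC1 : 0 < C1)
    (x z c : En n) (R d : ℝ) (hd0 : 0 < d) (hxz : ‖x - z‖ = d) (hsub : ball x (2 * d) ⊆ Ω)
    (hAB : ApproxBall ε Ω C1 x c R) :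
    ‖((∫ y in ball x (2 * d), (f y - f x) * (K (x - y) : ℂ)) + ∫ y in Ω \ ball x (2 * d), f y * (K (x - y) : ℂ)) -
      ((∫ y in ball x (2 * d), (f y - f z) * (K (z - y) : ℂ)) + ∫ y in Ω \ ball x (2 * d), f y * (K (z - y) : ℂ))‖ ≤
      (6 * nk (vb n) n (n - ε) + 2 ^ (n + 1) * fk (vb n) n (n + 1 - ε) + 2 * (2 ^ (n + 1) * fk C1 (n + ε) (n + 1)))
       * M * A * d ^ ε := by
  obtain ⟨hin, hvol, hbd⟩ := hAB
  have hM := h.nonneg hn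
  have hn1 : (1:ℝ) ≤ n := by exact_mod_cast hn
  have hΩf : volume Ω < ⊤ := hΩb.measure_lt_top
  have mΩ := hΩo.measurableSet
  have hinB := hin _ hsub
  have mB2 : MeasurableSet (ball c R) := measurableSet_ball
  have hdε : 0 < d ^ ε := by positivity
  set B := ball x (2 * d) with hBd
  have mB : MeasurableSet B := measurableSet_ball
  have hxB : x ∈ B := mem_ball_self (by linarith)
  have hzB : z ∈ B := by rw [hBd, mem_ball_iff_norm, norm_sub_rev, hxz]; linarith
  have hxΩ := hsub hxB
  have hzΩ := hsub hzB
  have hn0 : 0 ≤ nk (vb n) n (n - ε) := nk_nonneg (vb_nonneg n) (by linarith)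
  have hpow3 : (3 * d) ^ ε ≤ 3 * d ^ ε := by
    rw [Real.mul_rpow (by norm_num) hd0.le]
    gcongr
    calc (3:ℝ) ^ ε ≤ 3 ^ (1:ℝ) := Real.rpow_le_rpow_of_exponent_le (by norm_num) hε1.le
      _ = 3 := by simp
  have hpowm : d * (2 * d) ^ (ε - 1) ≤ d ^ ε := by
    calc d * (2 * d) ^ (ε - 1) ≤ d * d ^ (ε - 1) := by
          gcongr 1
          exact Real.rpow_le_rpow_of_nonpos hd0 (by linarith) (by linarith)
      _ = d ^ ε := by rw [Real.rpow_sub_one hd0.ne']; field_simp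
  obtain ⟨-, b1⟩ := near_part hn hε0 hε1 h hf hA x hxΩ B mB hsub (3 * d) (by linarith) (ball_subset_ball (by linarith))
  obtain ⟨-, b2⟩ := near_part hn hε0 hε1 h hf hA z hzΩ B mB hsub (3 * d) (by linarith) (by
    apply ball_subset_ball'
    rw [dist_eq_norm, hxz]; linarith)
  have hb3 : A * M * (nk (vb n) n (n - ε) * (3 * d) ^ ε) ≤ A * M * (nk (vb n) n (n - ε) * (3 * d ^ ε)) := by gcongr
  -- kernel difference
  have hkd : ∀ y, y ∉ B → ‖((K (x - y) : ℂ) - (K (z - y) : ℂ))‖ ≤ 2 ^ (n + 1) * M * d * ‖y - x‖ ^ (-((n:ℝ) + 1)) := by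
    intro y hy
    rw [hBd, mem_ball_iff_norm, not_lt] at hy
    have hyx : y ≠ x := by
      rintro rfl
      rw [sub_self, norm_zero] at hy
      linarith
    have := ker_diff hd hg x z y hyx (by linarith)
    rw [hxz] at this
    rw [← Complex.ofReal_sub, Complex.norm_real, Real.norm_eq_abs]
    exact this
  have hkm : Measurable (fun y => (K (x - y) : ℂ) - (K (z - y) : ℂ)) := (kerC_meas h x).sub (kerC_meas h z)
  have mS : MeasurableSet (Ω \ B) := mΩ.diff mB
  obtain ⟨i3, b3⟩ := far_int hn mS x (fun y => (f y - f x) * ((K (x - y) : ℂ) - (K (z - y) : ℂ)))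
    (((((hf.cont hε0).mono sdiff_subset).aestronglyMeasurable mS).sub aestronglyMeasurable_const).mul
      hkm.aestronglyMeasurable) (A * (2 ^ (n + 1) * M * d)) (vb n) n (n + 1 - ε) (2 * d) (by positivity) (vb_nonneg n)
      (by linarith) (by linarith) (by linarith) (vol_le _ x) disjoint_sdiff_left (by
      intro y hy hyx
      have hp : 0 < ‖y - x‖ := norm_pos_iff.2 (sub_ne_zero.2 hyx)
      rw [norm_mul]
      calc _ ≤ (A * ‖y - x‖ ^ ε) * (2 ^ (n + 1) * M * d * ‖y - x‖ ^ (-((n:ℝ) + 1))) := by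
            gcongr
            · exact hf.hol y hy.1 x hxΩ
            · exact hkd y hy.2
        _ = A * (2 ^ (n + 1) * M * d) * (‖y - x‖ ^ ε * ‖y - x‖ ^ (-((n:ℝ) + 1))) := by ring
        _ = _ := by rw [← Real.rpow_add hp]; congr 2; ring)
  have hf1 := fk_nonneg (C := vb n) (α := n) (β := n + 1 - ε) (vb_nonneg n) (by linarith)
  have hf2 := fk_nonneg (C := C1) (α := n + ε) (β := n + 1) hC1.le (by linarith)
  have b3' : ‖∫ y in Ω \ B, (f y - f x) * ((K (x - y) : ℂ) - (K (z - y) : ℂ))‖ ≤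
      A * 2 ^ (n + 1) * M * fk (vb n) n (n + 1 - ε) * d ^ ε := by
    refine b3.trans ?_
    rw [show (n:ℝ) - (n + 1 - ε) = ε - 1 by ring]
    calc _ = A * 2 ^ (n + 1) * M * fk (vb n) n (n + 1 - ε) * (d * (2 * d) ^ (ε - 1)) := by ring
      _ ≤ _ := by gcongr
  obtain ⟨δz, hδz, hsep⟩ := exists_sep hzB
  have hsz := (hsep δz le_rfl).2
  have kx : ∀ S, MeasurableSet S → volume S < ⊤ → Disjoint S B → IntegrableOn (fun y => (K (x - y) : ℂ)) S :=
    fun S hS hSf hSd => kerC_int hn h x S hS hSf (2 * d) (by linarith) hSd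
  have kz : ∀ S, MeasurableSet S → volume S < ⊤ → Disjoint S B → IntegrableOn (fun y => (K (z - y) : ℂ)) S :=
    fun S hS hSf hSd => kerC_int hn h z S hS hSf δz hδz (hSd.mono_right hsz)
  have hpart : ∀ S, MeasurableSet S → volume S < ⊤ → Disjoint S B → S ⊆ (Ω \ ball c R ∪ ball c R \ Ω) →
      ‖(∫ y in S, (K (x - y) : ℂ)) - ∫ y in S, (K (z - y) : ℂ)‖ ≤ 2 ^ (n + 1) * M * fk C1 (n + ε) (n + 1) * d ^ ε := by
    intro S hS hSf hSd hSs
    rw [← integral_sub (kx S hS hSf hSd) (kz S hS hSf hSd)]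
    have := (far_int hn hS x (fun y => (K (x - y) : ℂ) - (K (z - y) : ℂ)) hkm.aestronglyMeasurable
      (2 ^ (n + 1) * M * d) C1 (n + ε) (n + 1) (2 * d) (by positivity) hC1.le (by linarith) (by linarith) (by linarith)
      (fun r hr => (measure_mono (inter_subset_inter_left _ hSs)).trans (hvol r hr)) hSd
      (fun y hy _ => hkd y (Set.disjoint_left.1 hSd hy))).2
    refine this.trans ?_
    rw [show (n:ℝ) + ε - (n + 1) = ε - 1 by ring]
    calc _ = 2 ^ (n + 1) * M * fk C1 (n + ε) (n + 1) * (d * (2 * d) ^ (ε - 1)) := by ring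
      _ ≤ _ := by gcongr
  have fS : volume (Ω \ B) < ⊤ := lt_of_le_of_lt (measure_mono sdiff_subset) hΩf
  have b4 : ‖(∫ y in Ω \ B, (K (x - y) : ℂ)) - ∫ y in Ω \ B, (K (z - y) : ℂ)‖ ≤
      2 * (2 ^ (n + 1) * M * fk C1 (n + ε) (n + 1) * d ^ ε) := by
    rw [diff_lemma hn h mΩ hΩf c x x R (2 * d) hxB hinB hsub, diff_lemma hn h mΩ hΩf c x z R (2 * d) hzB hinB hsub]
    have p1 := hpart (Ω \ ball c R) (mΩ.diff mB2) (lt_of_le_of_lt (measure_mono sdiff_subset) hΩf)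
      (disjoint_sdiff_left.mono_right hinB) subset_union_left
    have p2 := hpart (ball c R \ Ω) (mB2.diff mΩ) (lt_of_le_of_lt (measure_mono sdiff_subset) measure_ball_lt_top)
      (disjoint_sdiff_left.mono_right hsub) subset_union_right
    rw [sub_sub_sub_comm]
    refine (norm_sub_le _ _).trans ?_
    linarith
  have b4' : ‖f x * ((∫ y in Ω \ B, (K (x - y) : ℂ)) - ∫ y in Ω \ B, (K (z - y) : ℂ))‖ ≤
      A * (2 * (2 ^ (n + 1) * M * fk C1 (n + ε) (n + 1) * d ^ ε)) := by
    rw [norm_mul]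
    gcongr
    exact hf.bd x hxΩ
  have e3 : (∫ y in Ω \ B, f y * (K (x - y) : ℂ)) - (∫ y in Ω \ B, f y * (K (z - y) : ℂ)) =
      (∫ y in Ω \ B, (f y - f x) * ((K (x - y) : ℂ) - (K (z - y) : ℂ))) +
      f x * ((∫ y in Ω \ B, (K (x - y) : ℂ)) - ∫ y in Ω \ B, (K (z - y) : ℂ)) := by
    have i4 : IntegrableOn (fun y => f x * ((K (x - y) : ℂ) - (K (z - y) : ℂ))) (Ω \ B) :=
      ((kx _ mS fS disjoint_sdiff_left).sub (kz _ mS fS disjoint_sdiff_left)).const_mul _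
    rw [← integral_sub (kx _ mS fS disjoint_sdiff_left) (kz _ mS fS disjoint_sdiff_left), ← integral_const_mul,
      ← integral_add i3 i4,
      ← integral_sub
        (fK_int hn hε0 h hf x _ mS sdiff_subset fS (2 * d) (by linarith) disjoint_sdiff_left)
        (fK_int hn hε0 h hf z _ mS sdiff_subset fS δz hδz (disjoint_sdiff_left.mono_right hsz))]
    congr 1
    funext y
    ring
  rw [add_sub_add_comm, e3]
  refine (norm_add_le _ _).trans ?_
  have q1 := norm_sub_le (∫ y in B, (f y - f x) * (K (x - y) : ℂ)) (∫ y in B, (f y - f z) * (K (z - y) : ℂ))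
  have q2 := norm_add_le (∫ y in Ω \ B, (f y - f x) * ((K (x - y) : ℂ) - (K (z - y) : ℂ)))
      (f x * ((∫ y in Ω \ B, (K (x - y) : ℂ)) - ∫ y in Ω \ B, (K (z - y) : ℂ)))
  calc _ ≤ 2 * (A * M * (nk (vb n) n (n - ε) * (3 * d ^ ε))) + (A * 2 ^ (n + 1) * M * fk (vb n) n (n + 1 - ε) * d ^ ε
        + A * (2 * (2 ^ (n + 1) * M * fk C1 (n + ε) (n + 1) * d ^ ε))) := by linarith
    _ = _ := by ring

theorem main_est {n : ℕ} (hn : 0 < n) {ε : ℝ} (hε0 : 0 < ε) (hε1 : ε < 1)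
    {Ω : Set (En n)} (hΩo : IsOpen Ω) (hΩb : Bornology.IsBounded Ω) {C1 : ℝ} (hC1 : 0 < C1)
    (hAB : ∀ x ∈ Ω, ∃ c R, ApproxBall ε Ω C1 x c R) :
    ∃ Q0 > 0, ∀ (K : En n → ℝ) (M : ℝ), IsKer n K M → (∀ v, v ≠ 0 → DifferentiableAt ℝ K v) →
      (∀ v, v ≠ 0 → ‖fderiv ℝ K v‖ * ‖v‖ ^ (n + 1) ≤ M) → ∀ (f : En n → ℂ) (A : ℝ), 0 ≤ A → LipF ε Ω A f →
      ∀ g : En n → ℂ, (∀ x ∈ Ω, Tendsto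
              (fun δ : ℝ => ∫ y in {y ∈ Ω | δ < dist y x}, f y * (K (x - y) : ℂ))
              (𝓝[>] 0) (𝓝 (g x))) →
      (∀ x ∈ Ω, ‖g x‖ ≤ Q0 * M * A) ∧
      (∀ x ∈ Ω, ∀ ρ > 0, ball x ρ ⊆ Ω → ∀ z, ‖x - z‖ ≤ ρ / 4 → ‖g x - g z‖ ≤ Q0 * M * A * ‖x - z‖ ^ ε) := by
  set Q1 := nk (vb n) n (n - ε) * (diam Ω + 1) ^ ε + 2 * (nk C1 (n + ε) n * C1 ^ ε) with hQ1
  set Q2 := 6 * nk (vb n) n (n - ε) + 2 ^ (n + 1) * fk (vb n) n (n + 1 - ε) + 2 * (2 ^ (n + 1) * fk C1 (n + ε) (n + 1))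
    with hQ2
  refine ⟨max 1 (max Q1 Q2), lt_max_of_lt_left one_pos, ?_⟩
  intro K M h hd hg f A hA hf g hlim
  have hM := h.nonneg hn
  have hΩf : volume Ω < ⊤ := hΩb.measure_lt_top
  have hrep : ∀ z c R, z ∈ ball c R → ball c R ⊆ Ω → g z =
      (∫ y in ball c R, (f y - f z) * (K (z - y) : ℂ)) + ∫ y in Ω \ ball c R, f y * (K (z - y) : ℂ) :=
    fun z c R hz hs => tendsto_nhds_unique (hlim z (hs hz)) (rep_lemma hn hε0 hε1 h hΩo hΩf hf hA c z R hz hs)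
  have hq1 : Q1 ≤ max 1 (max Q1 Q2) := (le_max_left _ _).trans (le_max_right _ _)
  have hq2 : Q2 ≤ max 1 (max Q1 Q2) := (le_max_right _ _).trans (le_max_right _ _)
  constructor
  · intro x hx
    obtain ⟨ρ, hρ, hs⟩ := Metric.isOpen_iff.1 hΩo x hx
    obtain ⟨c, R, hcR⟩ := hAB x hx
    rw [hrep x x ρ (mem_ball_self hρ) hs]
    refine (bound_est hn hε0 hε1 h hΩo hΩb hf hA hC1 x c R ρ hρ hs hcR).trans ?_
    gcongr
  · intro x hx ρ hρ hs z hz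
    rcases (norm_nonneg (x - z)).eq_or_lt with h0 | h0
    · have : x = z := by rw [← sub_eq_zero]; exact norm_eq_zero.1 h0.symm
      subst this
      simp only [sub_self, norm_zero]
      positivity
    · obtain ⟨c, R, hcR⟩ := hAB x hx
      have hs' : ball x (2 * ‖x - z‖) ⊆ Ω := (ball_subset_ball (by linarith)).trans hs
      rw [hrep x x (2 * ‖x - z‖) (mem_ball_self (by linarith)) hs', hrep z x (2 * ‖x - z‖)
        (by rw [mem_ball_iff_norm, norm_sub_rev]; linarith) hs']
      refine (holder_est hn hε0 hε1 h hd hg hΩo hΩb hf hA hC1 x z c R _ h0 rfl hs' hcR).trans ?_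
      gcongr

theorem chain_lemma {E : Type*} [NormedAddCommGroup E] [NormedSpace ℝ E] (Ω : Set E)
    (hΩo : IsOpen Ω) (ε : ℝ) (hε0 : 0 < ε) (c r0 : ℝ) (hc0 : 0 < c)
    (hc1 : c ≤ 1) (hr0 : 0 < r0)
    (hcone : ∀ x ∈ Ω, ∀ z ∈ Ω, ‖x - z‖ < r0 → (∃ a ∉ Ω, ‖x - a‖ < 4 * ‖x - z‖) →
      ∃ e : E, ‖e‖ = 1 ∧ ∀ t, 0 < t → t < r0 → ball (x - t • e) (c * t) ⊆ Ω ∧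
        ball (z - t • e) (c * t) ⊆ Ω) :
    ∃ C : ℝ, 0 < C ∧ ∀ (h : E → ℂ) (Q : ℝ), 0 ≤ Q → (∀ x ∈ Ω, ‖h x‖ ≤ Q) →
      (∀ x ∈ Ω, ∀ ρ > 0, ball x ρ ⊆ Ω → ∀ z, ‖x - z‖ ≤ ρ / 4 → ‖h x - h z‖ ≤ Q * ‖x - z‖ ^ ε) →
      ∀ x ∈ Ω, ∀ z ∈ Ω, ‖h x - h z‖ ≤ C * Q * ‖x - z‖ ^ ε := by
  set q : ℝ := 1 - c / 4 with hq
  have hq0 : 0 < q := by rw [hq]; linarith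
  have hq1 : q < 1 := by rw [hq]; linarith
  set B : ℝ := (1 - q ^ ε)⁻¹ with hB
  have hqε : q ^ ε < 1 := Real.rpow_lt_one hq0.le hq1 hε0
  have hqε0 : 0 < q ^ ε := by positivity
  have hBpos : 0 < B := by rw [hB]; apply inv_pos.2; linarith
  set d0 : ℝ := c * r0 / 8 with hd0
  have hd0pos : 0 < d0 := by positivity
  refine ⟨2 / d0 ^ ε + (1 + 2 * B * (4 / c) ^ ε), by positivity, ?_⟩
  intro h Q hQ hbd hloc x hx z hz
  -- step along the ray
  have ray : ∀ y ∈ Ω, ∀ e : E, ‖e‖ = 1 → ∀ T, 0 < T →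
      (∀ t, 0 < t → t ≤ T → ball (y - t • e) (c * t) ⊆ Ω) →
      ‖h (y - T • e) - h y‖ ≤ Q * T ^ ε * B := by
    intro y hy e he T hT hb
    have htk : ∀ k : ℕ, 0 < T * q ^ k ∧ T * q ^ k ≤ T := by
      intro k
      refine ⟨by positivity, ?_⟩
      have : q ^ k ≤ 1 := pow_le_one₀ hq0.le hq1.le
      nlinarith
    have hstep : ∀ k : ℕ, dist (h (y - (T * q ^ k) • e)) (h (y - (T * q ^ (k+1)) • e))
        ≤ Q * T ^ ε * (q ^ ε) ^ k := by
      intro k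
      obtain ⟨h1, h2⟩ := htk k
      have hball := hb _ h1 h2
      have hdiff : ‖(y - (T * q ^ k) • e) - (y - (T * q ^ (k+1)) • e)‖ = c * (T * q ^ k) / 4 := by
        have : (y - (T * q ^ k) • e) - (y - (T * q ^ (k+1)) • e)
            = (-(c * (T * q ^ k) / 4)) • e := by
          rw [sub_sub_sub_cancel_left, ← sub_smul]
          congr 1
          rw [pow_succ]
          have : q = 1 - c/4 := hq
          linear_combination (T * q^k) * this
        rw [this, norm_smul, he, mul_one, norm_neg, Real.norm_eq_abs, abs_of_nonneg (by positivity)]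
      have hc' : 0 < c * (T * q ^ k) := by positivity
      rw [dist_eq_norm]
      refine (hloc _ (hball (mem_ball_self hc')) _ hc' hball _ hdiff.le).trans ?_
      rw [hdiff, mul_assoc]
      gcongr
      have e1 : T ^ ε * (q ^ ε) ^ k = (T * q ^ k) ^ ε := by
        rw [Real.mul_rpow hT.le (by positivity), ← Real.rpow_natCast, ← Real.rpow_natCast,
          ← Real.rpow_mul hq0.le, ← Real.rpow_mul hq0.le, mul_comm ε]
      rw [e1]
      apply Real.rpow_le_rpow (by positivity) _ hε0.le
      nlinarith
    have htend : Tendsto (fun k : ℕ => h (y - (T * q ^ k) • e)) atTop (𝓝 (h y)) := by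
      obtain ⟨ρ, hρ, hρΩ⟩ := Metric.isOpen_iff.1 hΩo y hy
      have hn0 : Tendsto (fun k : ℕ => T * q ^ k) atTop (𝓝 0) := by
        have := (tendsto_pow_atTop_nhds_zero_of_lt_one hq0.le hq1).const_mul T
        simpa using this
      have hev : ∀ᶠ k : ℕ in atTop, T * q ^ k ≤ ρ / 4 :=
        (hn0.eventually (gt_mem_nhds (by positivity : (0:ℝ) < ρ / 4))).mono fun _ h => h.le
      rw [tendsto_iff_norm_sub_tendsto_zero]
      have hub : Tendsto (fun k : ℕ => Q * (T * q ^ k) ^ ε) atTop (𝓝 0) := by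
        have := (hn0.rpow_const (p := ε) (Or.inr hε0.le)).const_mul Q
        simpa [Real.zero_rpow hε0.ne'] using this
      refine squeeze_zero' (Eventually.of_forall fun _ => norm_nonneg _) ?_ hub
      filter_upwards [hev] with k hk
      have hnn : ‖y - (y - (T * q ^ k) • e)‖ = T * q ^ k := by
        rw [sub_sub_cancel, norm_smul, he, mul_one, Real.norm_eq_abs, abs_of_pos (htk k).1]
      have := hloc y hy ρ hρ hρΩ (y - (T * q ^ k) • e) (by rw [hnn]; exact hk)
      rw [hnn] at this
      rwa [norm_sub_rev]
    have := dist_le_of_le_geometric_of_tendsto₀ (q ^ ε) (Q * T ^ ε) hqε hstep htend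
    simpa [dist_eq_norm, hB, div_eq_mul_inv] using this
  rcases eq_or_ne x z with rfl | hxz
  · simp; positivity
  have hd : 0 < ‖x - z‖ := norm_pos_iff.2 (sub_ne_zero.2 hxz)
  set d := ‖x - z‖ with hdd
  have hdε : 0 < d ^ ε := by positivity
  by_cases hbig : d0 ≤ d
  · have h1 : ‖h x - h z‖ ≤ 2 * Q := by
      refine (norm_sub_le _ _).trans ?_
      linarith [hbd x hx, hbd z hz]
    have h2 : 2 * Q ≤ 2 / d0 ^ ε * Q * d ^ ε := by
      have : d0 ^ ε ≤ d ^ ε := Real.rpow_le_rpow hd0pos.le hbig hε0.le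
      have h3 : 1 ≤ d ^ ε / d0 ^ ε := by rwa [one_le_div (by positivity)]
      calc 2 * Q = 2 * Q * 1 := by ring
        _ ≤ 2 * Q * (d ^ ε / d0 ^ ε) := by gcongr
        _ = _ := by ring
    refine (h1.trans h2).trans ?_
    gcongr
    have : 0 < (1 + 2 * B * (4 / c) ^ ε) := by positivity
    linarith
  push Not at hbig
  have hd0r : d0 ≤ r0 := by rw [hd0]; nlinarith
  have hfin : ‖h x - h z‖ ≤ (1 + 2 * B * (4 / c) ^ ε) * Q * d ^ ε := by
    by_cases hex : ∃ a ∉ Ω, ‖x - a‖ < 4 * d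
    · obtain ⟨e, he, hcon⟩ := hcone x hx z hz (by linarith) hex
      set T := 4 * d / c with hT
      have hTpos : 0 < T := by positivity
      have hTr : T < r0 := by
        rw [hT, div_lt_iff₀ hc0]
        rw [hd0] at hbig
        nlinarith [mul_pos hc0 hr0]
      have r1 := ray x hx e he T hTpos fun t ht ht' => (hcon t ht (by linarith)).1
      have r2 := ray z hz e he T hTpos fun t ht ht' => (hcon t ht (by linarith)).2
      have hcT : 0 < c * T := by positivity
      have hbT := (hcon T hTpos hTr).1
      have hsub : ‖(x - T • e) - (z - T • e)‖ = d := by rw [sub_sub_sub_cancel_right]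
      have r3 := hloc (x - T • e) (hbT (mem_ball_self hcT)) (c * T) hcT hbT (z - T • e) (by
        rw [hsub, hT]; field_simp; linarith)
      rw [hsub] at r3
      have hTε : T ^ ε = (4 / c) ^ ε * d ^ ε := by
        rw [hT, ← Real.mul_rpow (by positivity) hd.le]; congr 1; ring
      have : ‖h x - h z‖ ≤ ‖h (x - T • e) - h x‖ + ‖h (x - T • e) - h (z - T • e)‖
          + ‖h (z - T • e) - h z‖ := by
        have : h x - h z = -(h (x - T • e) - h x) + (h (x - T • e) - h (z - T • e))
          + (h (z - T • e) - h z) := by ring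
        rw [this]
        refine (norm_add₃_le).trans ?_
        rw [norm_neg]
      rw [hTε] at r1 r2
      linarith
    · push Not at hex
      have hb : ball x (4 * d) ⊆ Ω := by
        intro y hy
        by_contra hyΩ
        have := hex y hyΩ
        rw [mem_ball_iff_norm, norm_sub_rev] at hy
        linarith
      have := hloc x hx (4 * d) (by positivity) hb z (by linarith)
      refine this.trans ?_
      rw [← hdd]
      gcongr
      have : 0 ≤ 2 * B * (4 / c) ^ ε := by positivity
      nlinarith
  refine hfin.trans ?_
  apply mul_le_mul_of_nonneg_right (mul_le_mul_of_nonneg_right _ hQ) hdε.le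
  have : 0 < 2 / d0 ^ ε := by positivity
  linarith

theorem ker_of_omega {n : ℕ} (hn : 0 < n) (ω K : En n → ℝ)
    (hK : ∀ x, x ≠ 0 → K x = ω x / ‖x‖ ^ n)
    (hh : ∀ t : ℝ, 0 < t → ∀ x, ω (t • x) = ω x)
    (he : ∀ x, ω (-x) = ω x)
    (hc : ContDiffOn ℝ 1 ω {(0 : En n)}ᶜ)
    (h0 : (∫ ξ in sphere (0 : En n) 1, ω ξ ∂μH[(n : ℝ) - 1]) = 0) :
    (∀ v, v ≠ 0 → DifferentiableAt ℝ K v) ∧ (∃ M, IsKer n K M) ∧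
    ∀ M, (∀ x, x ≠ 0 → |K x| * ‖x‖ ^ n ≤ M) → IsKer n K M := by
  have hopen : IsOpen ({(0 : En n)}ᶜ : Set (En n)) := isOpen_compl_singleton
  have hdiff : ∀ v, v ≠ 0 → DifferentiableAt ℝ K v := by
    intro v hv
    have h1 : DifferentiableAt ℝ ω v :=
      (hc.differentiableOn one_ne_zero).differentiableAt (hopen.mem_nhds hv)
    have h3 : DifferentiableAt ℝ (fun x : En n => ‖x‖ ^ n) v := (differentiableAt_id.norm ℝ hv).pow n
    have h2 : DifferentiableAt ℝ (fun x => ω x / ‖x‖ ^ n) v := by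
      have := h1.mul (h3.inv (pow_ne_zero _ (norm_ne_zero_iff.2 hv)))
      exact this.congr_of_eventuallyEq (Eventually.of_forall fun x => div_eq_mul_inv _ _)
    refine h2.congr_of_eventuallyEq ?_
    filter_upwards [hopen.mem_nhds hv] with x hx
    exact hK x hx
  have hmk : ∀ M, (∀ x, x ≠ 0 → |K x| * ‖x‖ ^ n ≤ M) → IsKer n K M := by
    intro M hM
    refine ⟨?_, ?_, ?_, hM, ?_⟩
    · apply measurable_of_measurable_on_compl_singleton 0
      apply Continuous.measurable
      have : ContinuousOn K {x | x ≠ 0} := fun x hx => (hdiff x hx).continuousAt.continuousWithinAt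
      exact this.domRestrict
    · intro x hx
      rw [hK _ (neg_ne_zero.2 hx), hK x hx, he, norm_neg]
    · intro t ht x hx
      rw [hK _ (smul_ne_zero ht.ne' hx), hK x hx, hh t ht, norm_smul, Real.norm_of_nonneg ht.le, mul_pow]
      field_simp
    · rw [← toSphere_integral_zero hn ω hc.continuousOn h0]
      congr 1
      funext θ
      have hθ : ‖(θ : En n)‖ = 1 := by simp
      have : (θ : En n) ≠ 0 := by rw [← norm_ne_zero_iff, hθ]; exact one_ne_zero
      rw [hK _ this, hθ]; simp
  refine ⟨hdiff, ?_, hmk⟩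
  have hsub : sphere (0 : En n) 1 ⊆ {(0 : En n)}ᶜ := by
    intro x hx
    rw [mem_sphere_zero_iff_norm] at hx
    simp only [mem_compl_iff, mem_singleton_iff]
    rintro rfl
    simp at hx
  obtain ⟨M, hM⟩ := (isCompact_sphere (0 : En n) 1).exists_bound_of_continuousOn (hc.continuousOn.mono hsub)
  refine ⟨M, hmk M fun x hx => ?_⟩
  have hp : 0 < ‖x‖ := norm_pos_iff.2 hx
  have h1 := hM (‖x‖⁻¹ • x) (by
    rw [mem_sphere_zero_iff_norm, norm_smul, norm_inv, norm_norm]; field_simp)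
  rw [hh _ (by positivity)] at h1
  rw [hK x hx, abs_div, abs_of_pos (by positivity : 0 < ‖x‖ ^ n), div_mul_cancel₀ _ (by positivity)]
  exact h1

theorem lipF_of {n : ℕ} {ε : ℝ} {Ω : Set (En n)} {f : En n → ℂ} (hε0 : 0 < ε)
    (hf : holderNorm ε Ω f ≠ ⊤) : LipF ε Ω (holderNorm ε Ω f).toReal f := by
  constructor
  · intro y hy
    have h1 : (‖f y‖₊ : ℝ≥0∞) ≤ holderNorm ε Ω f :=
      (le_iSup (fun x : Ω => (‖f x.1‖₊ : ℝ≥0∞)) ⟨y, hy⟩).trans le_self_add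
    have := ENNReal.toReal_mono hf h1
    simpa using this
  · intro y hy z hz
    have h1 : ENNReal.ofReal (‖f y - f z‖ / ‖y - z‖ ^ ε) ≤ holderNorm ε Ω f :=
      (le_iSup (fun p : Ω × Ω => ENNReal.ofReal (‖f p.1.1 - f p.2.1‖ / ‖p.1.1 - p.2.1‖ ^ ε)) ⟨⟨y, hy⟩, ⟨z, hz⟩⟩).trans
        le_add_self
    have h2 := (ENNReal.ofReal_le_iff_le_toReal hf).1 h1
    by_cases hyz : y = z
    · subst hyz
      simp [Real.zero_rpow hε0.ne']
    · have hp : 0 < ‖y - z‖ := norm_pos_iff.2 (sub_ne_zero.2 hyz)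
      rwa [div_le_iff₀ (by positivity)] at h2

theorem holderNorm_le {n : ℕ} {ε : ℝ} {Ω : Set (En n)} {g : En n → ℂ} {a b : ℝ} (ha : 0 ≤ a) (hb : 0 ≤ b)
    (h1 : ∀ x ∈ Ω, ‖g x‖ ≤ a)
    (h2 : ∀ x ∈ Ω, ∀ z ∈ Ω, ‖g x - g z‖ ≤ b * ‖x - z‖ ^ ε) : holderNorm ε Ω g ≤ ENNReal.ofReal (a + b) := by
  rw [ENNReal.ofReal_add ha hb]
  refine add_le_add (iSup_le fun x => ?_) (iSup_le fun p => ?_)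
  · rw [← enorm_eq_nnnorm, ← ofReal_norm]
    exact ENNReal.ofReal_le_ofReal (h1 x.1 x.2)
  · apply ENNReal.ofReal_le_ofReal
    apply div_le_of_le_mul₀ (by positivity) hb
    exact h2 _ p.1.2 _ p.2.2

/-- For a bounded `C^{1+ε}` domain `Ω ⊆ ℝ^n` and an even smooth homogeneous
Calderón–Zygmund operator `T` with kernel `K`, for every `f ∈ Lip(ε,Ω)` the principal value
`Tf(x)` exists at every `x ∈ Ω` and `‖Tf‖_{ε,Ω} ≤ C ‖T‖_CZ ‖f‖_{ε,Ω}` with `C = C(n,ε,Ω)`. -/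
theorem statement0 (n : ℕ) (ε : ℝ) (hε0 : 0 < ε) (hε1 : ε < 1)
    (Ω : Set (En n)) (hΩo : IsOpen Ω) (hΩc : IsConnected Ω)
    (hΩb : Bornology.IsBounded Ω) (hΩ : HasC1HolderBoundary n ε Ω) :
    ∃ C : ℝ≥0, 0 < C ∧
      ∀ ω K : En n → ℝ,
        (∀ x, x ≠ 0 → K x = ω x / ‖x‖ ^ n) →
        (∀ t : ℝ, 0 < t → ∀ x, ω (t • x) = ω x) →
        (∀ x, ω (-x) = ω x) →
        ContDiffOn ℝ 1 ω {(0 : En n)}ᶜ →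
        (∫ ξ in sphere (0 : En n) 1, ω ξ ∂μH[(n : ℝ) - 1]) = 0 →
        ∀ f : En n → ℂ, holderNorm ε Ω f ≠ ⊤ →
          ∃ g : En n → ℂ,
            (∀ x ∈ Ω, Tendsto
              (fun δ : ℝ => ∫ y in {y ∈ Ω | δ < dist y x}, f y * (K (x - y) : ℂ))
              (𝓝[>] 0) (𝓝 (g x))) ∧
            holderNorm ε Ω g ≤ ↑C * czConst n K * holderNorm ε Ω f := by
  have hn : 0 < n := hΩ.1
  have hΩf : volume Ω < ⊤ := hΩb.measure_lt_top
  obtain ⟨s, hs, hs1, hG⟩ := geom_uniform hε0 hΩo hΩb hΩ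
  obtain ⟨C1, hC1, hAB⟩ := tangent_ball hn hε0 hε1 hΩo hΩb hs hs1 hG
  obtain ⟨Q0, hQ0, hmain⟩ := main_est hn hε0 hε1 hΩo hΩb hC1 hAB
  obtain ⟨C2, hC2, hchain⟩ := chain_lemma Ω hΩo ε hε0 s (s / 6) hs hs1 (by linarith) (cone_cond hn hΩo hΩb hG)
  have hCpos : 0 < Q0 + C2 * Q0 := by positivity
  refine ⟨(Q0 + C2 * Q0).toNNReal, Real.toNNReal_pos.2 hCpos, ?_⟩
  intro ω K hK hh he hc h0 f hf
  obtain ⟨hdiff, ⟨M0, hM0⟩, hmk⟩ := ker_of_omega hn ω K hK hh he hc h0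
  have hLip := lipF_of hε0 hf
  set A := (holderNorm ε Ω f).toReal with hAd
  have hA : 0 ≤ A := ENNReal.toReal_nonneg
  have hex : ∀ x, ∃ L : ℂ, x ∈ Ω → Tendsto
      (fun δ : ℝ => ∫ y in {y ∈ Ω | δ < dist y x}, f y * (K (x - y) : ℂ)) (𝓝[>] 0) (𝓝 L) := by
    intro x
    by_cases hx : x ∈ Ω
    · obtain ⟨ρ, hρ, hsub⟩ := Metric.isOpen_iff.1 hΩo x hx
      exact ⟨_, fun _ => rep_lemma hn hε0 hε1 hM0 hΩo hΩf hLip hA x x ρ (mem_ball_self hρ) hsub⟩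
    · exact ⟨0, fun h => absurd h hx⟩
  choose g hg using hex
  refine ⟨g, hg, ?_⟩
  have hC0 : ((Q0 + C2 * Q0).toNNReal : ℝ≥0∞) ≠ 0 := by
    rw [ENNReal.coe_ne_zero]; exact (Real.toNNReal_pos.2 hCpos).ne'
  by_cases hcz : czConst n K = ⊤
  · by_cases hf0 : holderNorm ε Ω f = 0
    · have hA0 : A = 0 := by rw [hAd, hf0]; simp
      have hfz : ∀ y ∈ Ω, f y = 0 := by
        intro y hy
        have := hLip.bd y hy
        rw [hA0] at this
        exact norm_le_zero_iff.1 this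
      have hgz : ∀ x ∈ Ω, g x = 0 := by
        intro x hx
        refine tendsto_nhds_unique (hg x hx) ?_
        apply tendsto_const_nhds.congr
        intro δ
        symm
        apply setIntegral_eq_zero_of_forall_eq_zero
        intro y hy
        rw [hfz y hy.1, zero_mul]
      have := holderNorm_le (ε := ε) (Ω := Ω) (g := g) (a := 0) (b := 0) le_rfl le_rfl
        (fun x hx => by rw [hgz x hx]; simp) (fun x hx z hz => by rw [hgz x hx, hgz z hz]; simp)
      simp only [add_zero, ENNReal.ofReal_zero] at this
      exact this.trans bot_le
    · rw [hcz, ENNReal.mul_top hC0, ENNReal.top_mul hf0]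
      exact le_top
  · set M := (czConst n K).toReal with hMd
    have hb1 : ∀ x, x ≠ 0 → |K x| * ‖x‖ ^ n ≤ M := by
      intro x hx
      have h1 : ENNReal.ofReal (|K x| * ‖x‖ ^ n) ≤ czConst n K :=
        (le_iSup (fun x : {x : En n // x ≠ 0} => ENNReal.ofReal (|K x.1| * ‖x.1‖ ^ n)) ⟨x, hx⟩).trans le_self_add
      exact (ENNReal.ofReal_le_iff_le_toReal hcz).1 h1
    have hb2 : ∀ x, x ≠ 0 → ‖fderiv ℝ K x‖ * ‖x‖ ^ (n + 1) ≤ M := by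
      intro x hx
      have h1 : ENNReal.ofReal (‖fderiv ℝ K x‖ * ‖x‖ ^ (n + 1)) ≤ czConst n K :=
        (le_iSup (fun x : {x : En n // x ≠ 0} => ENNReal.ofReal (‖fderiv ℝ K x.1‖ * ‖x.1‖ ^ (n + 1))) ⟨x, hx⟩).trans
          le_add_self
      exact (ENNReal.ofReal_le_iff_le_toReal hcz).1 h1
    have hM : 0 ≤ M := ENNReal.toReal_nonneg
    obtain ⟨g1, g2⟩ := hmain K M (hmk M hb1) hdiff hb2 f A hA hLip g hg
    have g3 := hchain g (Q0 * M * A) (by positivity) g1 g2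
    have := holderNorm_le (by positivity) (by positivity) g1 g3
    refine this.trans (le_of_eq ?_)
    have e1 : Q0 * M * A + C2 * (Q0 * M * A) = (Q0 + C2 * Q0) * M * A := by ring
    rw [e1, ENNReal.ofReal_mul (by positivity), ENNReal.ofReal_mul hCpos.le, hMd, hAd, ENNReal.ofReal_toReal hcz,
      ENNReal.ofReal_toReal hf]
    rfl

end
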